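/- arXiv:1501.04548 — 4 statements merged into one kernel-verified Lean document; each statement's English description precedes it below -/
import Mathlib

section
/- Let f : ℝ → ℝ be a bounded continuous function centered with respect to π, i.e. ∫ f dπ = 0. Then the Poisson equation (m − y) v′(y) + (1/2) σ₂(y)² v″(y) = f(y) on ℝ has a C² solution v such that v′ is bounded on ℝ and v grows at most logarithmically: there exist constants C₁, C₂ > 0 with |v(y)| ≤ C₁·log(1 + |y|) + C₂ for all y ∈ ℝ. -/
open MeasureTheory

noncomputable section

/-- `E(y) = exp(∫₀^y 2(m - z)/σ₂(z)² dz)`. -/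
def Efun (m : ℝ) (σ₂ : ℝ → ℝ) (y : ℝ) : ℝ :=
  Real.exp (∫ z in (0:ℝ)..y, 2 * (m - z) / (σ₂ z) ^ 2)

/-- The normalizing constant `Z = ∫_ℝ E(y)/σ₂(y)² dy`. -/
def Zconst (m : ℝ) (σ₂ : ℝ → ℝ) : ℝ :=
  ∫ y : ℝ, Efun m σ₂ y / (σ₂ y) ^ 2

/-- The invariant measure `π` on `ℝ` with density `p(y) = Z⁻¹·E(y)/σ₂(y)²`
with respect to Lebesgue measure. -/
def pimeas (m : ℝ) (σ₂ : ℝ → ℝ) : Measure ℝ :=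
  volume.withDensity fun y => ENNReal.ofReal ((Zconst m σ₂)⁻¹ * (Efun m σ₂ y / (σ₂ y) ^ 2))

end

/-- If `E' = (m - z) h` with `E > 0` and `h ≥ 0`, then `h` is integrable at `+∞`, with tails
controlled by `E`. -/
lemma integrableOn_Ioi_and_tail_le {m : ℝ} {E h : ℝ → ℝ} (hE : ∀ y, 0 < E y)
    (hh : Continuous h) (hh0 : ∀ y, 0 ≤ h y) (hd : ∀ y, HasDerivAt E ((m - y) * h y) y)
    {y : ℝ} (hy : m < y) :
    IntegrableOn h (Set.Ioi y) ∧ ∫ z in Set.Ioi y, h z ≤ E y / (y - m) := by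
  have hym : 0 < y - m := sub_pos.2 hy
  have bound (R : ℝ) (hR : y ≤ R) : ∫ z in y..R, h z ≤ E y / (y - m) := by
    have hc : Continuous fun z => (m - z) * h z := by fun_prop
    have h1 : ∫ z in y..R, (m - z) * h z = E R - E y :=
      intervalIntegral.integral_eq_sub_of_hasDerivAt (fun z _ => hd z) (hc.intervalIntegrable _ _)
    have h2 : ∫ z in y..R, (y - m) * h z ≤ ∫ z in y..R, -((m - z) * h z) := by
      refine intervalIntegral.integral_mono_on hR
        ((continuous_const.mul hh).intervalIntegrable _ _) (hc.neg.intervalIntegrable _ _) ?_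
      intro z hz
      nlinarith [hh0 z, hz.1]
    rw [intervalIntegral.integral_const_mul, intervalIntegral.integral_neg, h1] at h2
    rw [le_div_iff₀ hym]
    linarith [hE R]
  have hint : IntegrableOn h (Set.Ioi y) := by
    refine integrableOn_Ioi_of_intervalIntegral_norm_bounded (E y / (y - m)) y
      (b := id) (l := Filter.atTop) (fun R => hh.integrableOn_Ioc) Filter.tendsto_id ?_
    filter_upwards [Filter.eventually_ge_atTop y] with R hR
    simpa [abs_of_nonneg (hh0 _)] using bound R hR
  refine ⟨hint, le_of_tendsto (intervalIntegral_tendsto_integral_Ioi y hint Filter.tendsto_id) ?_⟩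
  filter_upwards [Filter.eventually_ge_atTop y] with R hR using bound R hR

/-- Mirror image of `integrableOn_Ioi_and_tail_le` at `-∞`. -/
lemma integrableOn_Iic_and_tail_le {m : ℝ} {E h : ℝ → ℝ} (hE : ∀ y, 0 < E y)
    (hh : Continuous h) (hh0 : ∀ y, 0 ≤ h y) (hd : ∀ y, HasDerivAt E ((m - y) * h y) y)
    {y : ℝ} (hy : y < m) :
    IntegrableOn h (Set.Iic y) ∧ ∫ z in Set.Iic y, h z ≤ E y / (m - y) := by
  obtain ⟨h1, h2⟩ := integrableOn_Ioi_and_tail_le (m := -m) (E := fun z => E (-z))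
    (h := fun z => h (-z)) (fun z => hE _) (by fun_prop) (fun z => hh0 _)
    (fun z => by
      have h3 := (hd (-z)).comp z (hasDerivAt_neg z)
      rw [show (m - -z) * h (-z) * -1 = (-m - z) * h (-z) by ring] at h3
      exact h3) (neg_lt_neg hy)
  rw [integral_comp_neg_Ioi, neg_neg] at h2
  refine ⟨?_, by convert h2 using 2; ring⟩
  have h3 := h1.comp_neg
  simp only [neg_neg, Set.neg_Ioi] at h3
  exact (integrableOn_Iic_iff_integrableOn_Iio).2 h3

lemma integrable_of_hasDerivAt_sub_mul {m : ℝ} {E h : ℝ → ℝ} (hE : ∀ y, 0 < E y)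
    (hh : Continuous h) (hh0 : ∀ y, 0 ≤ h y) (hd : ∀ y, HasDerivAt E ((m - y) * h y) y) :
    Integrable h := by
  have h1 := (integrableOn_Ioi_and_tail_le hE hh hh0 hd (lt_add_one m)).1
  have h2 := (integrableOn_Iic_and_tail_le hE hh hh0 hd (sub_one_lt m)).1
  have h3 : IntegrableOn h (Set.Icc (m - 1) (m + 1)) := hh.integrableOn_Icc
  rw [← integrableOn_univ]
  refine ((h2.union h3).union h1).mono_set fun x _ => ?_
  simp only [Set.mem_union, Set.mem_Iic, Set.mem_Icc, Set.mem_Ioi]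
  grind

/-- If `g` is dominated by `M h` and has integral zero, its primitive vanishing at `±∞`
is at most `M E(y) / |y - m|`. -/
lemma abs_integral_Iic_le {m M : ℝ} {E h g : ℝ → ℝ} (hE : ∀ y, 0 < E y)
    (hh : Continuous h) (hh0 : ∀ y, 0 ≤ h y) (hd : ∀ y, HasDerivAt E ((m - y) * h y) y)
    (hM : 0 ≤ M) (hg : Integrable g) (hg0 : ∫ z, g z = 0) (hgh : ∀ z, |g z| ≤ M * h z)
    {y : ℝ} (hy : y ≠ m) :
    |∫ z in Set.Iic y, g z| ≤ M * (E y / |y - m|) := by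
  have hhi := integrable_of_hasDerivAt_sub_mul hE hh hh0 hd
  have key (s : Set ℝ) : |∫ z in s, g z| ≤ M * ∫ z in s, h z := by
    rw [← integral_const_mul]
    exact norm_integral_le_of_norm_le (f := g) (hhi.const_mul M).integrableOn (ae_of_all _ hgh)
  rcases hy.lt_or_gt with hy | hy
  · rw [abs_of_neg (sub_neg.2 hy), neg_sub]
    exact (key _).trans
      (mul_le_mul_of_nonneg_left (integrableOn_Iic_and_tail_le hE hh hh0 hd hy).2 hM)
  · have h1 : ∫ z in Set.Iic y, g z = -∫ z in Set.Ioi y, g z := by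
      have := intervalIntegral.integral_Iic_add_Ioi (b := y) hg.integrableOn hg.integrableOn
      linarith
    rw [abs_of_pos (sub_pos.2 hy), h1, abs_neg]
    exact (key _).trans
      (mul_le_mul_of_nonneg_left (integrableOn_Ioi_and_tail_le hE hh hh0 hd hy).2 hM)

lemma abs_le_mul_log_of_nonneg {K : ℝ} {v u : ℝ → ℝ} (hv0 : v 0 = 0)
    (hv : ∀ y, HasDerivAt v (u y) y) (hu : ∀ y, |u y| ≤ K / (1 + |y|)) {y : ℝ} (hy : 0 ≤ y) :
    |v y| ≤ K * Real.log (1 + y) := by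
  have hB (x : ℝ) (hx : 0 ≤ x) :
      HasDerivAt (fun x => K * Real.log (1 + x)) (K / (1 + x)) x := by
    have := (((hasDerivAt_id x).const_add 1).log (by simp; positivity)).const_mul K
    simpa [div_eq_mul_inv] using this
  refine image_norm_le_of_norm_deriv_right_le_deriv_boundary' (f := v) (f' := u) (a := 0) (b := y)
    (B := fun x => K * Real.log (1 + x)) (B' := fun x => K / (1 + x))
    (fun x _ => (hv x).continuousAt.continuousWithinAt) (fun x _ => (hv x).hasDerivWithinAt)
    (by simp [hv0]) (fun x hx => (hB x hx.1).continuousAt.continuousWithinAt)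
    (fun x hx => (hB x hx.1).hasDerivWithinAt) (fun x hx => ?_) ⟨hy, le_rfl⟩
  simpa [abs_of_nonneg hx.1] using hu x

lemma abs_le_mul_log {K : ℝ} {v u : ℝ → ℝ} (hv0 : v 0 = 0)
    (hv : ∀ y, HasDerivAt v (u y) y) (hu : ∀ y, |u y| ≤ K / (1 + |y|)) (y : ℝ) :
    |v y| ≤ K * Real.log (1 + |y|) := by
  rcases le_total 0 y with hy | hy
  · rw [abs_of_nonneg hy]
    exact abs_le_mul_log_of_nonneg hv0 hv hu hy
  · rw [abs_of_nonpos hy]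
    have := abs_le_mul_log_of_nonneg (K := K) (v := fun z => v (-z)) (u := fun z => -u (-z))
      (by simpa using hv0)
      (fun z => by
        have h1 := (hv (-z)).comp z (hasDerivAt_neg z)
        rw [mul_neg_one] at h1
        exact h1)
      (fun z => by simpa using hu (-z)) (neg_nonneg.2 hy)
    simpa using this

/-- A continuous function of size `O(1 / |y - m|)` away from `m` is of size `O(1 / (1 + |y|))`. -/
lemma exists_abs_le_div_one_add_abs {m M : ℝ} {u : ℝ → ℝ} (hu : Continuous u) (hM : 0 ≤ M)
    (hum : ∀ y, y ≠ m → |u y| ≤ M / |y - m|) :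
    ∃ K, 0 < K ∧ ∀ y, |u y| ≤ K / (1 + |y|) := by
  obtain ⟨K, hK⟩ := (isCompact_Icc (a := m - 1) (b := m + 1)).exists_bound_of_continuousOn
    (f := fun y => u y * (1 + |y|)) (by fun_prop)
  refine ⟨max K 1 + M * (2 + |m|), by positivity, fun y => ?_⟩
  have hpos : 0 < 1 + |y| := by positivity
  have hMm : 0 ≤ M * (2 + |m|) := by positivity
  rw [le_div_iff₀ hpos]
  by_cases hy : |y - m| ≤ 1
  · rw [abs_le] at hy
    have h1 := hK y ⟨by linarith, by linarith⟩
    rw [Real.norm_eq_abs, abs_mul, abs_of_pos hpos] at h1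
    linarith [le_max_left K 1]
  · have hym : 1 < |y - m| := not_le.1 hy
    have h1 := hum y (by rintro rfl; simp at hy)
    have h2 : 1 + |y| ≤ (2 + |m|) * |y - m| := by
      have : |y| ≤ |y - m| + |m| := by simpa using abs_add_le (y - m) m
      nlinarith [abs_nonneg m]
    have h3 : |u y| * (1 + |y|) ≤ M / |y - m| * ((2 + |m|) * |y - m|) := by gcongr
    have h4 : M / |y - m| * ((2 + |m|) * |y - m|) = M * (2 + |m|) := by
      field_simp
    linarith [le_max_right K 1]

lemma hasDerivAt_Efun (m : ℝ) {σ₂ : ℝ → ℝ} (hσ : Continuous σ₂) (hσ0 : ∀ y, 0 < σ₂ y) (y : ℝ) :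
    HasDerivAt (Efun m σ₂) ((m - y) * (2 * (Efun m σ₂ y / (σ₂ y) ^ 2))) y := by
  have hc : Continuous fun z => 2 * (m - z) / (σ₂ z) ^ 2 :=
    Continuous.div (by fun_prop) (by fun_prop) fun z => (pow_pos (hσ0 z) 2).ne'
  have h := (hc.integral_hasStrictDerivAt 0 y).hasDerivAt.exp
  refine h.congr_deriv ?_
  rw [Efun]
  ring

lemma integral_pimeas {m : ℝ} {σ₂ : ℝ → ℝ}
    (hc : Continuous fun y => Efun m σ₂ y / (σ₂ y) ^ 2) (f : ℝ → ℝ) :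
    ∫ y, f y ∂(pimeas m σ₂) =
      (Zconst m σ₂)⁻¹ * ∫ y, f y * (Efun m σ₂ y / (σ₂ y) ^ 2) := by
  have hnn (y : ℝ) : 0 ≤ Efun m σ₂ y / (σ₂ y) ^ 2 := div_nonneg (Real.exp_pos _).le (sq_nonneg _)
  have hZ : 0 ≤ Zconst m σ₂ := integral_nonneg hnn
  have hmeas : Measurable fun y =>
      ENNReal.ofReal ((Zconst m σ₂)⁻¹ * (Efun m σ₂ y / (σ₂ y) ^ 2)) :=
    ENNReal.measurable_ofReal.comp (continuous_const.mul hc).measurable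
  rw [pimeas, integral_withDensity_eq_integral_toReal_smul hmeas (by simp),
    ← integral_const_mul]
  congr 1 with y
  rw [ENNReal.toReal_ofReal (mul_nonneg (inv_nonneg.2 hZ) (hnn y)), smul_eq_mul]
  ring

/-- if `f` is bounded, continuous and centered w.r.t. `π`
(`∫ f dπ = 0`), then the Poisson equation `(m - y)v′ + (1/2)σ₂²v″ = f` has a C²
solution `v` with bounded derivative and at most logarithmic growth. -/
theorem poisson_solution_log_growth
    (m c₂ C₂ : ℝ) (σ₂ : ℝ → ℝ) (hσ₂c : Continuous σ₂)
    (hc₂ : 0 < c₂) (hσ₂ : ∀ y, c₂ ≤ σ₂ y ∧ σ₂ y ≤ C₂)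
    (f : ℝ → ℝ) (hfc : Continuous f) (hfb : ∃ M, ∀ y, |f y| ≤ M)
    (hcent : ∫ y, f y ∂(pimeas m σ₂) = 0) :
    ∃ v : ℝ → ℝ, ContDiff ℝ 2 v ∧
      (∀ y : ℝ, (m - y) * deriv v y + (1/2) * (σ₂ y) ^ 2 * deriv (deriv v) y = f y) ∧
      (∃ M, ∀ y : ℝ, |deriv v y| ≤ M) ∧
      (∃ C₁ C₂' : ℝ, 0 < C₁ ∧ 0 < C₂' ∧
        ∀ y : ℝ, |v y| ≤ C₁ * Real.log (1 + |y|) + C₂') := by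
  have hσ0 (y : ℝ) : 0 < σ₂ y := hc₂.trans_le (hσ₂ y).1
  have hE (y : ℝ) : 0 < Efun m σ₂ y := Real.exp_pos _
  have hdE := hasDerivAt_Efun m hσ₂c hσ0
  have hEc : Continuous (Efun m σ₂) :=
    continuous_iff_continuousAt.2 fun y => (hdE y).continuousAt
  have hpc : Continuous fun y => Efun m σ₂ y / (σ₂ y) ^ 2 :=
    hEc.div (by fun_prop) fun y => (pow_pos (hσ0 y) 2).ne'
  have hp0 (y : ℝ) : 0 < Efun m σ₂ y / (σ₂ y) ^ 2 := div_pos (hE y) (pow_pos (hσ0 y) 2)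
  obtain ⟨M, hM⟩ := hfb
  have hM0 : 0 ≤ M := (abs_nonneg _).trans (hM 0)
  set h : ℝ → ℝ := fun y => 2 * (Efun m σ₂ y / (σ₂ y) ^ 2) with hh
  have hhc : Continuous h := continuous_const.mul hpc
  have hh0 (y : ℝ) : 0 ≤ h y := mul_nonneg zero_le_two (hp0 y).le
  have hhi : Integrable h := integrable_of_hasDerivAt_sub_mul hE hhc hh0 hdE
  have hpi : Integrable fun y => Efun m σ₂ y / (σ₂ y) ^ 2 := by
    simpa [hh] using hhi.const_mul (1 / 2)
  have hZ : 0 < Zconst m σ₂ := by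
    refine (integral_pos_iff_support_of_nonneg (fun y => (hp0 y).le) hpi).2 ?_
    have hs : (Function.support fun y => Efun m σ₂ y / (σ₂ y) ^ 2) = Set.univ :=
      Set.eq_univ_of_forall fun y => (hp0 y).ne'
    simp [hs]
  have hgh (y : ℝ) : |f y * h y| ≤ M * h y := by
    rw [abs_mul, abs_of_nonneg (hh0 y)]
    exact mul_le_mul_of_nonneg_right (hM y) (hh0 y)
  have hgc : Continuous fun y => f y * h y := hfc.mul hhc
  have hgi : Integrable fun y => f y * h y :=
    (hhi.const_mul M).mono' hgc.aestronglyMeasurable (ae_of_all _ hgh)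
  have hg0 : ∫ y, f y * h y = 0 := by
    rw [integral_pimeas hpc, mul_eq_zero, or_iff_right (inv_ne_zero hZ.ne')] at hcent
    simp only [hh, mul_left_comm (f _) 2]
    rw [integral_const_mul, hcent, mul_zero]
  have hA (y : ℝ) : HasDerivAt (fun y => ∫ z in Set.Iic y, f z * h z) (f y * h y) y := by
    have heq : (fun y => ∫ z in Set.Iic y, f z * h z) =
        fun y => (∫ z in (0:ℝ)..y, f z * h z) + ∫ z in Set.Iic 0, f z * h z := by
      funext y
      rw [← intervalIntegral.integral_Iic_sub_Iic hgi.integrableOn hgi.integrableOn]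
      ring
    rw [heq]
    exact (hgc.integral_hasStrictDerivAt 0 y).hasDerivAt.add_const _
  set u : ℝ → ℝ := fun y => (∫ z in Set.Iic y, f z * h z) / Efun m σ₂ y with hu
  have hdu (y : ℝ) : HasDerivAt u (2 * (f y - (m - y) * u y) / (σ₂ y) ^ 2) y := by
    refine ((hA y).div (hdE y) (hE y).ne').congr_deriv ?_
    have h1 := (hE y).ne'
    have h2 := (hσ0 y).ne'
    simp only [hu, hh]
    field_simp
  have huc : Continuous u := continuous_iff_continuousAt.2 fun y => (hdu y).continuousAt
  obtain ⟨K, hK0, hK⟩ := exists_abs_le_div_one_add_abs (m := m) huc hM0 fun y hy => by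
    rw [hu, abs_div, abs_of_pos (hE y), div_le_iff₀ (hE y)]
    refine (abs_integral_Iic_le hE hhc hh0 hdE hM0 hgi hg0 hgh hy).trans_eq ?_
    ring
  have hdv (y : ℝ) : HasDerivAt (fun y => ∫ z in (0:ℝ)..y, u z) (u y) y :=
    (huc.integral_hasStrictDerivAt 0 y).hasDerivAt
  have hv' : deriv (fun y => ∫ z in (0:ℝ)..y, u z) = u := funext fun y => (hdv y).deriv
  have hu' : deriv u = fun y => 2 * (f y - (m - y) * u y) / (σ₂ y) ^ 2 :=
    funext fun y => (hdu y).deriv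
  refine ⟨fun y => ∫ z in (0:ℝ)..y, u z, ?_, fun y => ?_, ⟨K, fun y => ?_⟩,
    K, 1, hK0, one_pos, fun y => ?_⟩
  · rw [show (2 : WithTop ℕ∞) = 1 + 1 from one_add_one_eq_two.symm, contDiff_succ_iff_deriv, hv',
      contDiff_one_iff_deriv, hu']
    refine ⟨fun y => (hdv y).differentiableAt, by simp, fun y => (hdu y).differentiableAt, ?_⟩
    exact Continuous.div (by fun_prop) (by fun_prop) fun y => (pow_pos (hσ0 y) 2).ne'
  · rw [hv', hu']
    have h2 := (hσ0 y).ne'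
    field_simp
    ring
  · rw [hv']
    exact (hK y).trans (div_le_self hK0.le (by simp))
  · exact (abs_le_mul_log (by simp) hdv hK y).trans (by simp)
end

section
/- The function P₀(τ, x) = P_BS(τ, x; σ̄) satisfies the Black–Scholes partial differential equation ∂_τ P₀(τ, x) = (σ̄²/2)·(∂²ₓₓ P₀(τ, x) − ∂ₓ P₀(τ, x)) for all τ > 0 and x ∈ ℝ, and satisfies the put-payoff initial condition lim_{τ → 0⁺} P₀(τ, x) = max(K − K·e^x, 0) for every x ∈ ℝ. -/
noncomputable section

/-- Standard normal cumulative distribution function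
`N(z) = (1/√(2π)) ∫_{-∞}^z e^{-u²/2} du`. -/
def stdN (z : ℝ) : ℝ :=
  (Real.sqrt (2 * Real.pi))⁻¹ * ∫ u in Set.Iic z, Real.exp (-(u ^ 2) / 2)

/-- `d₁ = (x + σ²τ/2)/(σ√τ)`. -/
def d1 (σ τ x : ℝ) : ℝ := (x + σ ^ 2 * τ / 2) / (σ * Real.sqrt τ)

/-- `d₂ = (x - σ²τ/2)/(σ√τ)`. -/
def d2 (σ τ x : ℝ) : ℝ := (x - σ ^ 2 * τ / 2) / (σ * Real.sqrt τ)

/-- Black–Scholes put price in log-moneyness variable `x = log(S/K)`,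
as a function of time-to-maturity `τ`:
`P_BS(τ,x;σ) = K·N(-d₂) - K·eˣ·N(-d₁)`. -/
def PBS (K σ τ x : ℝ) : ℝ :=
  K * stdN (-(d2 σ τ x)) - K * Real.exp x * stdN (-(d1 σ τ x))

end

open Filter Topology MeasureTheory

/-- The standard normal density. -/
noncomputable def stdDensity (z : ℝ) : ℝ :=
  (Real.sqrt (2 * Real.pi))⁻¹ * Real.exp (-(z ^ 2) / 2)

theorem integrable_exp_neg_sq_div_two :
    Integrable (fun u : ℝ => Real.exp (-(u ^ 2) / 2)) := by
  convert integrable_exp_neg_mul_sq (b := 1 / 2) (by norm_num) using 3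
  ring

theorem stdN_eq_add_intervalIntegral (z : ℝ) :
    stdN z = stdN 0 + (Real.sqrt (2 * Real.pi))⁻¹ * ∫ u in (0 : ℝ)..z, Real.exp (-(u ^ 2) / 2) := by
  rw [← intervalIntegral.integral_Iic_sub_Iic integrable_exp_neg_sq_div_two.integrableOn
    integrable_exp_neg_sq_div_two.integrableOn]
  unfold stdN
  ring

theorem hasDerivAt_stdN (z : ℝ) : HasDerivAt stdN (stdDensity z) z := by
  have hc : Continuous fun u : ℝ => Real.exp (-(u ^ 2) / 2) := by fun_prop
  rw [funext stdN_eq_add_intervalIntegral]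
  exact ((hc.integral_hasStrictDerivAt 0 z).hasDerivAt.const_mul _).const_add _

theorem tendsto_stdN_atTop : Tendsto stdN atTop (𝓝 1) := by
  have hint : ∫ u : ℝ, Real.exp (-(u ^ 2) / 2) = Real.sqrt (2 * Real.pi) := by
    convert integral_gaussian (1 / 2) using 2
    · ext u
      ring_nf
    · ring
  have hpos : Real.sqrt (2 * Real.pi) ≠ 0 := by positivity
  have h := ((aecover_Iic tendsto_id).integral_tendsto_of_countably_generated
    integrable_exp_neg_sq_div_two).const_mul (Real.sqrt (2 * Real.pi))⁻¹
  rwa [hint, inv_mul_cancel₀ hpos] at h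

theorem tendsto_stdN_atBot : Tendsto stdN atBot (𝓝 0) := by
  simpa only [mul_zero] using! (tendsto_integral_Iic_zero (μ := volume)
    (f := fun u : ℝ => Real.exp (-(u ^ 2) / 2)) tendsto_id).const_mul (Real.sqrt (2 * Real.pi))⁻¹

theorem stdDensity_neg (z : ℝ) : stdDensity (-z) = stdDensity z := by
  simp [stdDensity]

section

variable {σ τ : ℝ}

theorem d1_eq_div_add (hσ : 0 < σ) (hτ : 0 < τ) (x : ℝ) :
    d1 σ τ x = x / (σ * √τ) + σ * √τ / 2 := by
  have h : 0 < √τ := Real.sqrt_pos.2 hτ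
  rw [d1]
  field_simp
  rw [Real.sq_sqrt hτ.le]

theorem d2_eq_div_sub (hσ : 0 < σ) (hτ : 0 < τ) (x : ℝ) :
    d2 σ τ x = x / (σ * √τ) - σ * √τ / 2 := by
  have h : 0 < √τ := Real.sqrt_pos.2 hτ
  rw [d2]
  field_simp
  rw [Real.sq_sqrt hτ.le]

theorem stdDensity_d2 (hσ : 0 < σ) (hτ : 0 < τ) (x : ℝ) :
    stdDensity (d2 σ τ x) = Real.exp x * stdDensity (d1 σ τ x) := by
  have h : 0 < √τ := Real.sqrt_pos.2 hτ
  rw [stdDensity, stdDensity, mul_left_comm, ← Real.exp_add, d1_eq_div_add hσ hτ,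
    d2_eq_div_sub hσ hτ]
  congr 2
  field_simp
  ring

theorem hasDerivAt_d1_right (σ τ x : ℝ) : HasDerivAt (d1 σ τ) (1 / (σ * √τ)) x :=
  ((hasDerivAt_id x).add_const _).div_const _

theorem hasDerivAt_d2_right (σ τ x : ℝ) : HasDerivAt (d2 σ τ) (1 / (σ * √τ)) x :=
  ((hasDerivAt_id x).sub_const _).div_const _

theorem exists_hasDerivAt_d1_d2_left (hσ : 0 < σ) (hτ : 0 < τ) (x : ℝ) :
    ∃ D, HasDerivAt (fun t => d1 σ t x) D τ ∧
      HasDerivAt (fun t => d2 σ t x) (D - σ * (1 / (2 * √τ))) τ := by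
  have h : σ * √τ ≠ 0 := by positivity
  have hs := (Real.hasDerivAt_sqrt hτ.ne').const_mul σ
  have h1 : HasDerivAt (fun t => d1 σ t x) _ τ :=
    ((((hasDerivAt_id τ).const_mul (σ ^ 2)).div_const 2).const_add x).div hs h
  refine ⟨_, h1, (h1.sub hs).congr_of_eventuallyEq ?_⟩
  filter_upwards [lt_mem_nhds hτ] with t ht
  simp only [Pi.sub_apply, d1_eq_div_add hσ ht, d2_eq_div_sub hσ ht]
  ring

theorem hasDerivAt_PBS_right (K : ℝ) (hσ : 0 < σ) (hτ : 0 < τ) (x : ℝ) :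
    HasDerivAt (PBS K σ τ) (-(K * Real.exp x * stdN (-(d1 σ τ x)))) x := by
  have h1 := (hasDerivAt_stdN _).comp x (hasDerivAt_d1_right σ τ x).neg
  have h2 := (hasDerivAt_stdN _).comp x (hasDerivAt_d2_right σ τ x).neg
  refine ((h2.const_mul K).sub (((Real.hasDerivAt_exp x).const_mul K).mul h1)).congr_deriv ?_
  simp only [Pi.neg_apply, Function.comp_apply, stdDensity_neg, stdDensity_d2 hσ hτ]
  ring

theorem hasDerivAt_deriv_PBS_right (K : ℝ) (hσ : 0 < σ) (hτ : 0 < τ) (x : ℝ) :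
    HasDerivAt (deriv (PBS K σ τ)) (-(K * Real.exp x * stdN (-(d1 σ τ x))) +
      K * Real.exp x * stdDensity (d1 σ τ x) / (σ * √τ)) x := by
  rw [funext fun y => (hasDerivAt_PBS_right K hσ hτ y).deriv]
  have h1 := (hasDerivAt_stdN _).comp x (hasDerivAt_d1_right σ τ x).neg
  refine (((Real.hasDerivAt_exp x).const_mul K).mul h1).neg.congr_deriv ?_
  simp only [Pi.neg_apply, Function.comp_apply, stdDensity_neg]
  ring

theorem hasDerivAt_PBS_left (K : ℝ) (hσ : 0 < σ) (hτ : 0 < τ) (x : ℝ) :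
    HasDerivAt (fun t => PBS K σ t x)
      (K * Real.exp x * stdDensity (d1 σ τ x) * (σ / (2 * √τ))) τ := by
  obtain ⟨D, hd1, hd2⟩ := exists_hasDerivAt_d1_d2_left hσ hτ x
  have h1 := (hasDerivAt_stdN _).comp τ hd1.neg
  have h2 := (hasDerivAt_stdN _).comp τ hd2.neg
  refine ((h2.const_mul K).sub (h1.const_mul (K * Real.exp x))).congr_deriv ?_
  simp only [Pi.neg_apply, stdDensity_neg, stdDensity_d2 hσ hτ]
  ring

theorem tendsto_mul_sqrt_nhdsGT_zero (hσ : 0 < σ) :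
    Tendsto (fun t => σ * √t) (𝓝[>] 0) (𝓝[>] 0) := by
  refine tendsto_nhdsWithin_iff.2 ⟨?_, ?_⟩
  · have h : Continuous fun t => σ * √t := by fun_prop
    simpa using (h.tendsto 0).mono_left nhdsWithin_le_nhds
  · filter_upwards [self_mem_nhdsWithin] with t ht
    exact mul_pos hσ (Real.sqrt_pos.2 ht)

theorem tendsto_d1_d2_nhdsGT_zero (hσ : 0 < σ) {x : ℝ} {l : Filter ℝ}
    (h : ∀ c : ℝ → ℝ, Tendsto c (𝓝[>] 0) (𝓝 0) →
      Tendsto (fun s => x * s⁻¹ + c s) (𝓝[>] 0) l) :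
    Tendsto (fun t => d1 σ t x) (𝓝[>] 0) l ∧ Tendsto (fun t => d2 σ t x) (𝓝[>] 0) l := by
  have hid : Tendsto (fun s : ℝ => s) (𝓝[>] 0) (𝓝 0) := tendsto_id.mono_right nhdsWithin_le_nhds
  constructor
  · refine ((h (fun s => s / 2) (by simpa using hid.div_const 2)).comp
      (tendsto_mul_sqrt_nhdsGT_zero hσ)).congr' ?_
    filter_upwards [self_mem_nhdsWithin] with t ht
    simp only [Function.comp_apply, d1_eq_div_add hσ ht, div_eq_mul_inv]
  · refine ((h (fun s => -(s / 2)) (by simpa using (hid.div_const 2).neg)).comp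
      (tendsto_mul_sqrt_nhdsGT_zero hσ)).congr' ?_
    filter_upwards [self_mem_nhdsWithin] with t ht
    simp only [Function.comp_apply, d2_eq_div_sub hσ ht, div_eq_mul_inv, sub_eq_add_neg]

theorem tendsto_PBS_of_tendsto_stdN (K : ℝ) {x a : ℝ} {l : Filter ℝ} {m : Filter ℝ}
    (h : Tendsto (fun t => d1 σ t x) m l ∧ Tendsto (fun t => d2 σ t x) m l)
    (ha : Tendsto (fun z => stdN (-z)) l (𝓝 a)) :
    Tendsto (fun t => PBS K σ t x) m (𝓝 (K * a - K * Real.exp x * a)) :=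
  ((ha.comp h.2).const_mul K).sub ((ha.comp h.1).const_mul (K * Real.exp x))

theorem tendsto_PBS_nhdsGT_zero {K : ℝ} (hσ : 0 < σ) (hK : 0 < K) (x : ℝ) :
    Tendsto (fun t => PBS K σ t x) (𝓝[>] 0) (𝓝 (max (K - K * Real.exp x) 0)) := by
  rcases lt_trichotomy x 0 with hx | rfl | hx
  · have hd := tendsto_d1_d2_nhdsGT_zero (x := x) (l := atBot) hσ fun c hc =>
      (tendsto_inv_nhdsGT_zero.const_mul_atTop_of_neg hx).atBot_add hc
    have h := tendsto_PBS_of_tendsto_stdN K hd (tendsto_stdN_atTop.comp tendsto_neg_atBot_atTop)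
    rw [max_eq_left (by nlinarith [Real.exp_lt_one_iff.2 hx])]
    simpa using h
  · have hd := tendsto_d1_d2_nhdsGT_zero (x := 0) (l := 𝓝 0) hσ fun c hc => by simpa using hc
    have h := tendsto_PBS_of_tendsto_stdN K hd
      ((hasDerivAt_stdN _).continuousAt.tendsto.comp (continuous_neg.tendsto 0))
    simpa using h
  · have hd := tendsto_d1_d2_nhdsGT_zero (x := x) (l := atTop) hσ fun c hc =>
      (tendsto_inv_nhdsGT_zero.const_mul_atTop hx).atTop_add hc
    have h := tendsto_PBS_of_tendsto_stdN K hd (tendsto_stdN_atBot.comp tendsto_neg_atTop_atBot)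
    rw [max_eq_right (by nlinarith [Real.one_lt_exp_iff.2 hx])]
    simpa using h

end

/-- `P₀(τ,x) = P_BS(τ,x;σ̄)` solves the Black–Scholes PDE
`∂_τ P₀ = (σ̄²/2)(∂²ₓₓP₀ - ∂ₓP₀)` for `τ > 0`, and satisfies the put-payoff
initial condition `P₀(τ,x) → max(K - K eˣ, 0)` as `τ → 0⁺`. -/
theorem P0_BlackScholes_PDE_and_initial (σb K : ℝ) (hσ : 0 < σb) (hK : 0 < K) :
    (∀ τ : ℝ, 0 < τ → ∀ x : ℝ,
      deriv (fun t => PBS K σb t x) τ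
        = σb ^ 2 / 2 *
            (deriv (deriv (fun x' => PBS K σb τ x')) x - deriv (fun x' => PBS K σb τ x') x)) ∧
    (∀ x : ℝ,
      Filter.Tendsto (fun τ => PBS K σb τ x) (nhdsWithin 0 (Set.Ioi 0))
        (nhds (max (K - K * Real.exp x) 0))) := by
  refine ⟨fun τ hτ x => ?_, tendsto_PBS_nhdsGT_zero hσ hK⟩
  have hτ' : 0 < √τ := Real.sqrt_pos.2 hτ
  rw [(hasDerivAt_PBS_left K hσ hτ x).deriv, (hasDerivAt_deriv_PBS_right K hσ hτ x).deriv,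
    (hasDerivAt_PBS_right K hσ hτ x).deriv]
  field_simp
  ring
end

section
/- For every τ > 0 and x ∈ ℝ, the Black–Scholes put price is differentiable in the volatility parameter and its derivative (vega) is given by ∂/∂σ [P_BS(τ, x; σ)] = K·√τ·e^{−d₂²/2}/√(2π), where d₂ = (x − σ²τ/2)/(σ√τ), for every σ > 0. -/
theorem hasDerivAt_integral_Iic {f : ℝ → ℝ} (hf : Continuous f)
    (hint : MeasureTheory.Integrable f) (z : ℝ) :
    HasDerivAt (fun t => ∫ u in Set.Iic t, f u) (f z) z := by
  have hftc : HasDerivAt (fun t => (∫ u in Set.Iic z, f u) + ∫ u in z..t, f u) (f z) z :=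
    (intervalIntegral.integral_hasDerivAt_right (hf.intervalIntegrable z z)
      hf.stronglyMeasurable.stronglyMeasurableAtFilter hf.continuousAt).const_add _
  convert hftc using 2 with t
  rw [← intervalIntegral.integral_Iic_sub_Iic hint.integrableOn hint.integrableOn]
  ring

theorem hasDerivAt_stdN_s8 (z : ℝ) :
    HasDerivAt stdN ((Real.sqrt (2 * Real.pi))⁻¹ * Real.exp (-(z ^ 2) / 2)) z := by
  have hint : MeasureTheory.Integrable (fun u : ℝ => Real.exp (-(u ^ 2) / 2)) := by
    convert integrable_exp_neg_mul_sq (b := 1 / 2) (by norm_num) using 3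
    ring
  exact (hasDerivAt_integral_Iic (by fun_prop) hint z).const_mul _

theorem d1_eq_d2_add {σ τ : ℝ} (hσ : 0 < σ) (hτ : 0 < τ) (x : ℝ) :
    d1 σ τ x = d2 σ τ x + σ * Real.sqrt τ := by
  have hs := Real.sqrt_pos.2 hτ
  have hsq := Real.sq_sqrt hτ.le
  unfold d1 d2
  field_simp
  rw [hsq]
  ring

theorem differentiableAt_d2 {σ τ : ℝ} (hσ : 0 < σ) (hτ : 0 < τ) (x : ℝ) :
    DifferentiableAt ℝ (fun s => d2 s τ x) σ := by
  have hs := Real.sqrt_pos.2 hτ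
  unfold d2
  fun_prop (disch := positivity)

/-- The discounted densities at `d₁` and `d₂` agree: `eˣ e^{-d₁²/2} = e^{-d₂²/2}`. -/
theorem exp_mul_exp_neg_d1_sq {σ τ : ℝ} (hσ : 0 < σ) (hτ : 0 < τ) (x : ℝ) :
    Real.exp x * Real.exp (-(d1 σ τ x) ^ 2 / 2) = Real.exp (-(d2 σ τ x) ^ 2 / 2) := by
  have hs := Real.sqrt_pos.2 hτ
  have hd2 : d2 σ τ x * (σ * Real.sqrt τ) = x - σ ^ 2 * τ / 2 :=
    div_mul_cancel₀ _ (by positivity)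
  rw [← Real.exp_add, d1_eq_d2_add hσ hτ]
  congr 1
  linear_combination -hd2 - σ ^ 2 / 2 * Real.sq_sqrt hτ.le

/-- Black–Scholes vega. For every `τ > 0`, `x ∈ ℝ` and `σ > 0`,
`σ ↦ P_BS(τ,x;σ)` is differentiable with derivative `K·√τ·e^{-d₂²/2}/√(2π)`. -/
theorem BlackScholes_vega (K : ℝ) (hK : 0 < K) :
    ∀ τ : ℝ, 0 < τ → ∀ x : ℝ, ∀ σ : ℝ, 0 < σ →
      HasDerivAt (fun σ' => PBS K σ' τ x)
        (K * Real.sqrt τ * Real.exp (-(d2 σ τ x) ^ 2 / 2) / Real.sqrt (2 * Real.pi)) σ := by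
  intro τ hτ x σ hσ
  obtain ⟨d, hd2⟩ : ∃ d, HasDerivAt (fun s => d2 s τ x) d σ :=
    ⟨_, (differentiableAt_d2 hσ hτ x).hasDerivAt⟩
  have hd1 : HasDerivAt (fun s => d1 s τ x) (d + 1 * Real.sqrt τ) σ := by
    refine (hd2.add ((hasDerivAt_id σ).mul_const (Real.sqrt τ))).congr_of_eventuallyEq ?_
    filter_upwards [lt_mem_nhds hσ] with s hs
    exact d1_eq_d2_add hs hτ x
  have hN1 := (hasDerivAt_stdN_s8 (-(d1 σ τ x))).comp σ hd1.neg
  have hN2 := (hasDerivAt_stdN_s8 (-(d2 σ τ x))).comp σ hd2.neg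
  refine ((hN2.const_mul K).sub (hN1.const_mul (K * Real.exp x))).congr_deriv ?_
  simp only [neg_sq]
  rw [div_eq_mul_inv (K * Real.sqrt τ * _) (Real.sqrt (2 * Real.pi))]
  linear_combination
    K * (Real.sqrt (2 * Real.pi))⁻¹ * (d + Real.sqrt τ) * exp_mul_exp_neg_d1_sq hσ hτ x
end

section
/- Comparison principle for the pricing operator: let T > 0, ε > 0, and suppose u : [0, T] × ℝ × ℝ → ℝ is bounded and continuous, C^{1,2,2} on (0, T) × ℝ × ℝ, and satisfies ∂_τ u = L_ε u there. Suppose w : [0, T] × ℝ × ℝ → ℝ is continuous, C^{1,2,2} on (0, T) × ℝ × ℝ, satisfies ∂_τ w − L_ε w ≤ −κ on (0, T) × ℝ × ℝ for some κ > 0, satisfies the growth bound w(τ, x, y) ≤ C₀ − c₀·(y − m)² for all (τ, x, y) and some constants C₀ ∈ ℝ, c₀ > 0, and satisfies w(0, x, y) ≤ u(0, x, y) for all (x, y). Then w(τ, x, y) ≤ u(τ, x, y) for all (τ, x, y) ∈ [0, T] × ℝ × ℝ. -/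
noncomputable section

/-- The (nonlinear) pricing operator `L_ε` acting on a function `g(x,y)`:
`L_ε g = (1/2)σ₁²∂²ₓₓg + (1/(2ε))σ₂²∂²ᵧᵧg + (ρ/√ε)σ₁σ₂∂²ₓᵧg
  + ((m-y)/ε - (ρ/√ε)bσ₂/σ₁)∂ᵧg - (1/2)σ₁²∂ₓg - b²/(2γσ₁²)
  + (γ(1-ρ²)/(2ε))σ₂²(∂ᵧg)² - (η√(1-ρ²)/√ε)(bσ₂/σ₁)∂ᵧg`. -/
def Lop (m γ η ρ ε : ℝ) (b σ₁ σ₂ : ℝ → ℝ) (g : ℝ → ℝ → ℝ) (x y : ℝ) : ℝ :=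
  (1/2) * (σ₁ y) ^ 2 * deriv (deriv (fun x' => g x' y)) x
  + (1 / (2 * ε)) * (σ₂ y) ^ 2 * deriv (deriv (fun y' => g x y')) y
  + (ρ / Real.sqrt ε) * σ₁ y * σ₂ y * deriv (fun y' => deriv (fun x' => g x' y') x) y
  + ((m - y) / ε - (ρ / Real.sqrt ε) * (b y * σ₂ y / σ₁ y)) * deriv (fun y' => g x y') y
  - (1/2) * (σ₁ y) ^ 2 * deriv (fun x' => g x' y) x
  - (b y) ^ 2 / (2 * γ * (σ₁ y) ^ 2)
  + (γ * (1 - ρ ^ 2) / (2 * ε)) * (σ₂ y) ^ 2 * (deriv (fun y' => g x y') y) ^ 2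
  - (η * Real.sqrt (1 - ρ ^ 2) / Real.sqrt ε) * (b y * σ₂ y / σ₁ y)
      * deriv (fun y' => g x y') y

/-- `u(τ,x,y)` is `C^{1,2,2}` for `τ` in the set `s`: once differentiable in `τ`
and twice differentiable in each of the spatial variables `x, y`
(including the mixed partial `∂²ₓᵧ`). -/
def C122On (s : Set ℝ) (u : ℝ → ℝ → ℝ → ℝ) : Prop :=
  ∀ τ ∈ s, ∀ x y : ℝ,
    DifferentiableAt ℝ (fun t => u t x y) τ ∧
    DifferentiableAt ℝ (fun x' => u τ x' y) x ∧
    DifferentiableAt ℝ (deriv (fun x' => u τ x' y)) x ∧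
    DifferentiableAt ℝ (fun y' => u τ x y') y ∧
    DifferentiableAt ℝ (deriv (fun y' => u τ x y')) y ∧
    DifferentiableAt ℝ (fun y' => deriv (fun x' => u τ x' y') x) y

end

section Comparison

open Set Filter Topology MeasureTheory
open scoped NNReal

theorem abs_taylor_two_le {g : ℝ → ℝ} {x : ℝ} (hg : Differentiable ℝ g)
    (hg' : DifferentiableAt ℝ (deriv g) x) {e : ℝ} (he : 0 < e) :
    ∃ r > 0, ∀ h : ℝ, |h| < r →
      |g (x + h) - g x - deriv g x * h - deriv (deriv g) x / 2 * h ^ 2| ≤ e * h ^ 2 := by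
  have h1 := hg'.hasDerivAt.isLittleO.def he
  obtain ⟨r, hr, hball⟩ := Metric.eventually_nhds_iff.1 h1
  refine ⟨r, hr, fun h hh => ?_⟩
  set φ : ℝ → ℝ := fun s =>
    g (x + s) - deriv g x * s - deriv (deriv g) x / 2 * s ^ 2 with hφ
  have hd : ∀ s, HasDerivAt φ (deriv g (x + s) - deriv g x - deriv (deriv g) x * s) s := by
    intro s
    have a1 : HasDerivAt (fun s => g (x + s)) (deriv g (x + s)) s := by
      simpa using HasDerivAt.comp_const_add x s (hg (x + s)).hasDerivAt
    have a2 := (hasDerivAt_id s).const_mul (deriv g x)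
    have a3 := ((hasDerivAt_id s).pow 2).const_mul (deriv (deriv g) x / 2)
    refine ((a1.sub a2).sub a3).congr_deriv ?_
    simp; ring
  have hb : ∀ s ∈ Set.uIcc 0 h, ‖deriv φ s‖ ≤ e * |h| := by
    intro s hs
    have hs' : |s| ≤ |h| := by
      simpa using Set.abs_sub_left_of_mem_uIcc hs
    rw [(hd s).deriv]
    have h2 := hball (y := x + s) (by simpa [Real.dist_eq] using hs'.trans_lt hh)
    simp only [add_sub_cancel_left, smul_eq_mul, Real.norm_eq_abs] at h2
    rw [Real.norm_eq_abs, mul_comm (deriv (deriv g) x)]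
    exact h2.trans (mul_le_mul_of_nonneg_left hs' he.le)
  have := (convex_uIcc 0 h).norm_image_sub_le_of_norm_deriv_le
    (fun s _ => (hd s).differentiableAt) hb Set.left_mem_uIcc Set.right_mem_uIcc
  simp only [hφ, Real.norm_eq_abs, sub_zero, add_zero] at this
  calc _ = |g (x + h) - deriv g x * h - deriv (deriv g) x / 2 * h ^ 2
        - (g x - deriv g x * 0 - deriv (deriv g) x / 2 * 0 ^ 2)| := by congr 1; ring
    _ ≤ e * |h| * |h| := this
    _ = e * h ^ 2 := by rw [mul_assoc, ← sq, sq_abs]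

theorem exists_nat_quadratic_lower_bound {g : ℝ → ℝ} {x : ℝ} (hg : Differentiable ℝ g)
    (hg' : DifferentiableAt ℝ (deriv g) x) :
    ∃ N : ℕ, ∀ h : ℝ, |h| ≤ 1 → g x + deriv g x * h - N * h ^ 2 ≤ g (x + h) := by
  obtain ⟨r, hr, ht⟩ := abs_taylor_two_le hg hg' one_pos
  set φ : ℝ → ℝ := fun h => g (x + h) - g x - deriv g x * h with hφ
  have hc : Continuous φ := by
    have := hg.continuous
    fun_prop
  obtain ⟨B, hB⟩ := (isCompact_Icc (a := (-1 : ℝ)) (b := 1)).exists_bound_of_continuousOn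
    hc.continuousOn
  obtain ⟨N, hN⟩ := exists_nat_ge (max (|deriv (deriv g) x / 2| + 1) (B / r ^ 2))
  refine ⟨N, fun h hh => ?_⟩
  rcases lt_or_ge |h| r with hlt | hge
  · have h1 := (abs_le.1 (ht h hlt)).1
    have h2 := (le_max_left _ _).trans hN
    have h3 := neg_abs_le (deriv (deriv g) x / 2)
    nlinarith [sq_nonneg h]
  · have h1 := hB h (abs_le.1 hh)
    have h2 := (le_max_right _ _).trans hN
    rw [div_le_iff₀ (by positivity)] at h2
    have h3 : r ^ 2 ≤ h ^ 2 := by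
      rw [← sq_abs h]; gcongr
    have h4 : (N : ℝ) * r ^ 2 ≤ N * h ^ 2 := by gcongr
    rw [Real.norm_eq_abs] at h1
    have := (abs_le.1 h1).1
    simp only [hφ] at this
    linarith

theorem exists_nat_left_lower_bound {g : ℝ → ℝ} {t : ℝ} (hc : ContinuousOn g (Icc 0 t))
    (hd : DifferentiableAt ℝ g t) :
    ∃ N : ℕ, ∀ s ∈ Icc 0 t, g t - N * (t - s) ≤ g s := by
  have h1 := hd.hasDerivAt.isLittleO.def one_pos
  obtain ⟨r, hr, hball⟩ := Metric.eventually_nhds_iff.1 h1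
  obtain ⟨B, hB⟩ := isCompact_Icc.exists_bound_of_continuousOn hc
  obtain ⟨N, hN⟩ := exists_nat_ge (max (|deriv g t| + 1) (2 * B / r))
  refine ⟨N, fun s hs => ?_⟩
  have hts : 0 ≤ t - s := sub_nonneg.2 hs.2
  rcases lt_or_ge (t - s) r with hlt | hge
  · have h2 := hball (y := s) (by rwa [Real.dist_eq, abs_sub_comm, abs_of_nonneg hts])
    simp only [smul_eq_mul, Real.norm_eq_abs, one_mul, abs_sub_comm s t, abs_of_nonneg hts] at h2
    have h3 := (abs_le.1 h2).1
    have h4 := (le_max_left _ _).trans hN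
    have h5 := le_abs_self (deriv g t)
    nlinarith
  · have h2 := (le_max_right _ _).trans hN
    rw [div_le_iff₀ hr] at h2
    have h3 : (N : ℝ) * r ≤ N * (t - s) := by gcongr
    have h4 := (abs_le.1 (hB s hs)).1
    have h5 := (abs_le.1 (hB t (right_mem_Icc.2 (hs.1.trans hs.2)))).2
    rw [mul_comm] at h2
    linarith

theorem exists_right_approx_of_not_countable {s : Set ℝ} (hs : ¬ s.Countable) :
    ∃ x ∈ s, ∀ r > 0, ∃ k, 0 < k ∧ k < r ∧ x + k ∈ s := by
  by_contra! hcon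
  refine hs (Countable.mono ?_ (countable_setOfPred_isolated_right_within (s := s)))
  intro x hx
  refine ⟨hx, ?_⟩
  obtain ⟨r, hr, hk⟩ := hcon x hx
  rw [← empty_mem_iff_bot, mem_nhdsWithin_iff_exists_mem_nhds_inter]
  refine ⟨Iio (x + r), Iio_mem_nhds (by linarith), ?_⟩
  rintro y ⟨hy1, hy2, hy3⟩
  exact hk (y - x) (sub_pos.2 hy3) (by simp at hy1; linarith) (by simpa using hy2)

theorem LipschitzOnWith.volume_image_eq_zero {K : ℝ≥0} {f : ℝ → ℝ} {s : Set ℝ}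
    (hf : LipschitzOnWith K f s) (hs : volume s = 0) : volume (f '' s) = 0 := by
  have := hf.hausdorffMeasure_image_le (d := 1) zero_le_one
  rw [hausdorffMeasure_real, hs, mul_zero] at this
  exact le_antisymm this bot_le

theorem LipschitzOnWith.volume_image_prod_eq_zero {K : ℝ≥0} {f : ℝ × ℝ → ℝ × ℝ}
    {s : Set (ℝ × ℝ)} (hf : LipschitzOnWith K f s) (hs : volume s = 0) :
    volume (f '' s) = 0 := by
  have := hf.hausdorffMeasure_image_le (d := 2) zero_le_two
  rw [hausdorffMeasure_prod_real, hs, mul_zero] at this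
  exact le_antisymm this bot_le

/-- All the spatial derivatives entering `Lop` exist at every point. -/
def TwiceSepDifferentiable (F : ℝ → ℝ → ℝ) : Prop :=
  ∀ x y : ℝ,
    DifferentiableAt ℝ (fun x' => F x' y) x ∧
    DifferentiableAt ℝ (deriv (fun x' => F x' y)) x ∧
    DifferentiableAt ℝ (fun y' => F x y') y ∧
    DifferentiableAt ℝ (deriv (fun y' => F x y')) y ∧
    DifferentiableAt ℝ (fun y' => deriv (fun x' => F x' y') x) y

/-- The affine function of slope `p` through the graph of `F` at `z` lies above `F`. -/
def TouchedFromAbove (F : ℝ → ℝ → ℝ) (p z : ℝ × ℝ) : Prop :=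
  ∀ x y : ℝ, F x y ≤ F z.1 z.2 + p.1 * (x - z.1) + p.2 * (y - z.2)

/-- The pair of partial derivatives of `F`. -/
noncomputable def sepGradient (F : ℝ → ℝ → ℝ) (z : ℝ × ℝ) : ℝ × ℝ :=
  (deriv (fun x => F x z.2) z.1, deriv (fun y => F z.1 y) z.2)

theorem deriv_eq_of_forall_le_affine {g : ℝ → ℝ} {x p : ℝ} (hg : DifferentiableAt ℝ g x)
    (h : ∀ x', g x' ≤ g x + p * (x' - x)) : deriv g x = p := by
  have hd : HasDerivAt (fun x' => g x' - p * (x' - x)) (deriv g x - p) x := by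
    refine (hg.hasDerivAt.sub (((hasDerivAt_id x).sub_const x).const_mul p)).congr_deriv ?_
    simp
  have hm : IsLocalMax (fun x' => g x' - p * (x' - x)) x :=
    Eventually.of_forall fun x' => by
      simp only [sub_self, mul_zero, sub_zero]
      linarith [h x']
  linarith [hm.hasDerivAt_eq_zero hd]

theorem TouchedFromAbove.sepGradient_eq {F : ℝ → ℝ → ℝ} {p z : ℝ × ℝ}
    (h : TouchedFromAbove F p z) (hF : TwiceSepDifferentiable F) : sepGradient F z = p := by
  obtain ⟨hx, -, hy, -, -⟩ := hF z.1 z.2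
  refine Prod.ext (deriv_eq_of_forall_le_affine hx fun x' => ?_)
    (deriv_eq_of_forall_le_affine hy fun y' => ?_)
  · simpa using h x' z.2
  · simpa using h z.1 y'

/-- A cross-shaped quadratic lower bound for `F` at `z`. -/
def CrossLowerBound (F : ℝ → ℝ → ℝ) (N : ℝ) (p z : ℝ × ℝ) : Prop :=
  ∀ h : ℝ, |h| ≤ 1 →
    F z.1 z.2 + p.1 * h - N * h ^ 2 ≤ F (z.1 + h) z.2 ∧
    F z.1 z.2 + p.2 * h - N * h ^ 2 ≤ F z.1 (z.2 + h)

theorem TwiceSepDifferentiable.exists_crossLowerBound {F : ℝ → ℝ → ℝ}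
    (hF : TwiceSepDifferentiable F) (z : ℝ × ℝ) :
    ∃ N : ℕ, CrossLowerBound F N (sepGradient F z) z := by
  obtain ⟨N, hN⟩ := exists_nat_quadratic_lower_bound (g := fun x => F x z.2) (x := z.1)
    (fun x => (hF x z.2).1) (hF z.1 z.2).2.1
  obtain ⟨M, hM⟩ := exists_nat_quadratic_lower_bound (g := fun y => F z.1 y) (x := z.2)
    (fun y => (hF z.1 y).2.2.1) (hF z.1 z.2).2.2.2.1
  refine ⟨max N M, fun h hh => ⟨le_trans ?_ (hN h hh), le_trans ?_ (hM h hh)⟩⟩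
  · have : (N : ℝ) ≤ (max N M : ℕ) := by exact_mod_cast le_max_left _ _
    simp only [sepGradient]
    gcongr
  · have : (M : ℝ) ≤ (max N M : ℕ) := by exact_mod_cast le_max_right _ _
    simp only [sepGradient]
    gcongr

theorem TouchedFromAbove.abs_sub_slope_le {F : ℝ → ℝ → ℝ} {N d : ℝ} {p q z z' : ℝ × ℝ}
    (hp : TouchedFromAbove F p z) (hN : CrossLowerBound F N p z)
    (hq : TouchedFromAbove F q z') (hd : 0 < d) (hd4 : 4 * d ≤ 1)
    (h1 : |z.1 - z'.1| ≤ d) (h2 : |z.2 - z'.2| ≤ d) :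
    |q.1 - p.1| ≤ 8 * N * d ∧ |q.2 - p.2| ≤ 8 * N * d := by
  have hzz := hp z'.1 z'.2
  have hb1 : (q.1 - p.1) * (z.1 - z'.1) ≤ |q.1 - p.1| * d :=
    (le_abs_self _).trans (by rw [abs_mul]; gcongr)
  have hb2 : (q.2 - p.2) * (z.2 - z'.2) ≤ |q.2 - p.2| * d :=
    (le_abs_self _).trans (by rw [abs_mul]; gcongr)
  have key1 : ∀ h : ℝ, |h| ≤ 1 →
      -(q.1 - p.1) * h - N * h ^ 2 ≤ |q.1 - p.1| * d + |q.2 - p.2| * d := fun h hh => by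
    have a1 := (hN h hh).1
    have a2 := hq (z.1 + h) z.2
    nlinarith
  have key2 : ∀ h : ℝ, |h| ≤ 1 →
      -(q.2 - p.2) * h - N * h ^ 2 ≤ |q.1 - p.1| * d + |q.2 - p.2| * d := fun h hh => by
    have a1 := (hN h hh).2
    have a2 := hq z.1 (z.2 + h)
    nlinarith
  have hab : |4 * d| ≤ 1 := by rwa [abs_of_pos (by positivity)]
  have hab' : |-(4 * d)| ≤ 1 := by rwa [abs_neg]
  have c1 : 4 * |q.1 - p.1| - 16 * N * d ≤ |q.1 - p.1| + |q.2 - p.2| := by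
    have := key1 _ hab
    have := key1 _ hab'
    refine le_of_mul_le_mul_right ?_ hd
    rcases abs_cases (q.1 - p.1) with h | h <;> nlinarith
  have c2 : 4 * |q.2 - p.2| - 16 * N * d ≤ |q.1 - p.1| + |q.2 - p.2| := by
    have := key2 _ hab
    have := key2 _ hab'
    refine le_of_mul_le_mul_right ?_ hd
    rcases abs_cases (q.2 - p.2) with h | h <;> nlinarith
  constructor <;> linarith

theorem volume_slopes_eq_zero {F : ℝ → ℝ → ℝ} (hF : TwiceSepDifferentiable F) {r : ℝ}
    {K S : Set (ℝ × ℝ)} (hK : volume K = 0) (hSr : ∀ p ∈ S, |p.1| ≤ r ∧ |p.2| ≤ r)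
    (hS : ∀ p ∈ S, ∃ z ∈ K, TouchedFromAbove F p z) : volume S = 0 := by
  set KN : ℕ → Set (ℝ × ℝ) := fun N => {z | z ∈ K ∧ sepGradient F z ∈ S ∧
    TouchedFromAbove F (sepGradient F z) z ∧ CrossLowerBound F N (sepGradient F z) z} with hKN
  have hsub : S ⊆ ⋃ N, sepGradient F '' KN N := by
    intro p hp
    obtain ⟨z, hz, ht⟩ := hS p hp
    have hgrad := ht.sepGradient_eq hF
    obtain ⟨N, hN⟩ := hF.exists_crossLowerBound z
    exact mem_iUnion.2 ⟨N, z, ⟨hz, hgrad ▸ hp, hgrad ▸ ht, hN⟩, hgrad⟩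
  refine measure_mono_null hsub (measure_iUnion_null fun N => ?_)
  refine LipschitzOnWith.volume_image_prod_eq_zero
    (K := Real.toNNReal (max (8 * N) (8 * r))) ?_ (measure_mono_null (fun z hz => hz.1) hK)
  refine LipschitzOnWith.of_dist_le_mul fun z hz z' hz' => ?_
  have hmax : 0 ≤ max (8 * (N : ℝ)) (8 * r) := le_max_of_le_left (by positivity)
  rw [Real.coe_toNNReal _ hmax]
  rcases eq_or_ne z z' with rfl | hne
  · simp
  have hdpos := dist_pos.2 hne
  have h1 : |z'.1 - z.1| ≤ dist z z' := by
    rw [abs_sub_comm, ← Real.dist_eq]; exact le_max_left _ _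
  have h2 : |z'.2 - z.2| ≤ dist z z' := by
    rw [abs_sub_comm, ← Real.dist_eq]; exact le_max_right _ _
  have hbound : ∀ s : ℝ, s ≤ max (8 * (N : ℝ)) (8 * r) →
      |(sepGradient F z).1 - (sepGradient F z').1| ≤ s * dist z z' →
      |(sepGradient F z).2 - (sepGradient F z').2| ≤ s * dist z z' →
      dist (sepGradient F z) (sepGradient F z') ≤ max (8 * (N : ℝ)) (8 * r) * dist z z' :=
    fun s hs a1 a2 => (max_le a1 a2).trans (by gcongr)
  rcases le_or_gt (4 * dist z z') 1 with hle | hgt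
  · have := hz'.2.2.1.abs_sub_slope_le hz'.2.2.2 hz.2.2.1 hdpos hle h1 h2
    exact hbound _ (le_max_left _ _) this.1 this.2
  · have hr1 := hSr _ hz.2.1
    have hr2 := hSr _ hz'.2.1
    have hr0 : 0 ≤ r := (abs_nonneg _).trans hr1.1
    refine hbound _ (le_max_right _ _) ?_ ?_
    · have := abs_sub (sepGradient F z).1 (sepGradient F z').1
      nlinarith [hr1.1, hr2.1]
    · have := abs_sub (sepGradient F z).2 (sepGradient F z').2
      nlinarith [hr1.2, hr2.2]

theorem exists_hessian_le_of_not_countable {F : ℝ → ℝ → ℝ} (hF : TwiceSepDifferentiable F)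
    {x : ℝ} {Y : Set ℝ} (hY : ¬ Y.Countable) (ht : ∀ y ∈ Y, ∃ p, TouchedFromAbove F p (x, y))
    {e : ℝ} (he : 0 < e) :
    ∃ y ∈ Y, ∀ ξ ζ : ℝ,
      deriv (deriv (fun x' => F x' y)) x * ξ ^ 2
        + 2 * deriv (fun y' => deriv (fun x' => F x' y') x) y * ξ * ζ
        + deriv (deriv (fun y' => F x y')) y * ζ ^ 2 ≤ e * (ξ ^ 2 + ζ ^ 2) := by
  set d : ℝ := e / 4 with hd_def
  have hd : 0 < d := by positivity
  set A : ℝ → ℝ := fun y => deriv (deriv (fun x' => F x' y)) x with hA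
  set piece : ℕ × ℤ → Set ℝ := fun j => {y | y ∈ Y ∧ ⌊A y / d⌋ = j.2 ∧
    ∀ h : ℝ, |h| < 1 / ((j.1 : ℝ) + 1) →
      F x y + deriv (fun x' => F x' y) x * h + A y / 2 * h ^ 2 - d * h ^ 2 ≤ F (x + h) y}
    with hpiece
  have hcov : Y ⊆ ⋃ j, piece j := by
    intro y hy
    obtain ⟨r, hr, hT⟩ := abs_taylor_two_le (g := fun x' => F x' y) (x := x)
      (fun x' => (hF x' y).1) (hF x y).2.1 hd
    obtain ⟨N, hN⟩ := exists_nat_one_div_lt hr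
    refine mem_iUnion.2 ⟨(N, ⌊A y / d⌋), hy, rfl, fun h hh => ?_⟩
    have := (abs_le.1 (hT h (hh.trans hN))).1
    simp only [hA]
    linarith
  obtain ⟨j, hj⟩ : ∃ j, ¬ (piece j).Countable := by
    by_contra! hcon
    exact hY ((countable_iUnion hcon).mono hcov)
  obtain ⟨y, hy, happ⟩ := exists_right_approx_of_not_countable hj
  refine ⟨y, hy.1, fun ξ ζ => ?_⟩
  obtain ⟨p, hp⟩ := ht y hy.1
  have hgrad := hp.sepGradient_eq hF
  have hp1 : deriv (fun x' => F x' y) x = p.1 := congrArg Prod.fst hgrad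
  have hp2 : deriv (fun y' => F x y') y = p.2 := congrArg Prod.snd hgrad
  have hj0 : (0 : ℝ) < 1 / ((j.1 : ℝ) + 1) := by positivity
  change A y * ξ ^ 2 + _ + _ ≤ _
  rcases eq_or_ne ζ 0 with rfl | hζ
  · set h : ℝ := 1 / ((j.1 : ℝ) + 1) / 2 with hh
    have hpos : 0 < h := by positivity
    have a1 := hy.2.2 h (by rw [abs_of_pos hpos]; linarith)
    have a2 := hp (x + h) y
    simp only [add_sub_cancel_left, sub_self, mul_zero, add_zero] at a2
    rw [hp1] at a1
    have a3 : A y * h ^ 2 ≤ (2 * d) * h ^ 2 := by linarith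
    have a4 := le_of_mul_le_mul_right a3 (by positivity)
    have : A y ≤ e := by linarith
    nlinarith [mul_le_mul_of_nonneg_right this (sq_nonneg ξ)]
  · obtain ⟨r₁, hr₁, hT₁⟩ := abs_taylor_two_le (g := fun y' => F x y') (x := y)
      (fun y' => (hF x y').2.2.1) (hF x y).2.2.2.1 hd
    obtain ⟨r₂, hr₂, hT₂⟩ := Metric.eventually_nhds_iff.1
      ((hF x y).2.2.2.2.hasDerivAt.isLittleO.def hd)
    set c := deriv (deriv (fun y' => F x y')) y
    set b := deriv (fun y' => deriv (fun x' => F x' y') x) y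
    have hζ' : 0 < |ζ| := abs_pos.2 hζ
    obtain ⟨k, hk0, hk, hky⟩ := happ
      (min r₁ (min r₂ (1 / ((j.1 : ℝ) + 1) * (|ζ| / (|ξ| + 1))))) (by positivity)
    obtain ⟨hk1, hk2, hk3⟩ : k < r₁ ∧ k < r₂ ∧
        k < 1 / ((j.1 : ℝ) + 1) * (|ζ| / (|ξ| + 1)) := by simpa [lt_min_iff] using hk
    set μ := k / ζ with hμ
    have hkμ : μ * ζ = k := div_mul_cancel₀ _ hζ
    have hμ0 : μ ≠ 0 := div_ne_zero hk0.ne' hζ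
    have hh : |μ * ξ| < 1 / ((j.1 : ℝ) + 1) := by
      rw [abs_mul, hμ, abs_div, abs_of_pos hk0]
      calc k / |ζ| * |ξ| ≤ k / |ζ| * (|ξ| + 1) := by gcongr; linarith
        _ < 1 / ((j.1 : ℝ) + 1) * (|ζ| / (|ξ| + 1)) / |ζ| * (|ξ| + 1) := by gcongr
        _ = 1 / ((j.1 : ℝ) + 1) := by field_simp
    have b1 := hky.2.2 _ hh
    have b2 := (abs_le.1 (hT₁ k (by rwa [abs_of_pos hk0]))).1
    have b3 := hT₂ (y := y + k) (by rwa [Real.dist_eq, add_sub_cancel_left, abs_of_pos hk0])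
    simp only [add_sub_cancel_left, smul_eq_mul, Real.norm_eq_abs] at b3
    have b4 := hp (x + μ * ξ) (y + k)
    simp only [add_sub_cancel_left] at b4
    have b5 : A y - d ≤ A (y + k) := by
      have f1 := Int.lt_floor_add_one (A (y + k) / d)
      have f2 := Int.floor_le (A y / d)
      have f3 := Int.lt_floor_add_one (A y / d)
      have f4 := Int.floor_le (A (y + k) / d)
      rw [hky.2.1] at f1 f4
      rw [hy.2.1] at f2 f3
      have : (A y - A (y + k)) / d < 1 := by rw [sub_div]; linarith
      rw [div_lt_one hd] at this
      linarith
    have b6 : deriv (fun x' => F x' y) x * (μ * ξ) + k * b * (μ * ξ) - d * |k| * |μ * ξ| ≤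
        deriv (fun x' => F x' (y + k)) x * (μ * ξ) := by
      have : |(deriv (fun x' => F x' (y + k)) x - deriv (fun x' => F x' y) x - k * b)
          * (μ * ξ)| ≤ d * |k| * |μ * ξ| := by rw [abs_mul]; gcongr
      have := (abs_le.1 this).1
      linarith
    have b7 : |k| * |μ * ξ| ≤ (k ^ 2 + (μ * ξ) ^ 2) / 2 := by
      nlinarith [sq_nonneg (|k| - |μ * ξ|), sq_abs k, sq_abs (μ * ξ)]
    have b8 := mul_le_mul_of_nonneg_right b5 (sq_nonneg (μ * ξ))
    have b9 := mul_le_mul_of_nonneg_left b7 hd.le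
    rw [hp1] at b6
    rw [hp2] at b2
    have hfin : A y * (μ * ξ) ^ 2 + 2 * b * (μ * ξ) * k + c * k ^ 2 ≤
        e * ((μ * ξ) ^ 2 + k ^ 2) := by
      have : e = 4 * d := by rw [hd_def]; ring
      rw [this]
      nlinarith [mul_nonneg hd.le (sq_nonneg k), mul_nonneg hd.le (sq_nonneg (μ * ξ))]
    rw [← hkμ] at hfin
    refine le_of_mul_le_mul_right ?_ (by positivity : 0 < μ ^ 2)
    linarith

theorem deriv_nonneg_of_forall_Icc_le {g : ℝ → ℝ} {t : ℝ} (ht : 0 < t)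
    (hg : DifferentiableAt ℝ g t) (h : ∀ s ∈ Icc 0 t, g s ≤ g t) : 0 ≤ deriv g t := by
  have h1 := hasDerivWithinAt_iff_tendsto_slope'
    (self_notMem_Iio (a := t)) |>.1 hg.hasDerivAt.hasDerivWithinAt
  refine ge_of_tendsto h1 ?_
  filter_upwards [Ioo_mem_nhdsLT ht] with s hs
  rw [slope_def_field]
  exact div_nonneg_of_nonpos (sub_nonpos.2 (h s ⟨hs.1.le, hs.2.le⟩)) (sub_nonpos.2 hs.2.le)

theorem volume_eq_zero_of_lipschitz_relation {V T : Set ℝ} (hT : volume T = 0)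
    (rel : ℕ → ℝ → ℝ → Prop) (hV : ∀ v ∈ V, ∃ N, ∃ t ∈ T, rel N t v)
    (hrel : ∀ N t t' v v', rel N t v → rel N t' v' → |v - v'| ≤ N * |t - t'|) :
    volume V = 0 := by
  classical
  set φ : ℕ → ℝ → ℝ := fun N t => if h : ∃ v, rel N t v then h.choose else 0
  have hφ : ∀ N t v, rel N t v → rel N t (φ N t) := fun N t v h => by
    have h' : ∃ v, rel N t v := ⟨v, h⟩
    simp only [φ, dif_pos h']
    exact h'.choose_spec
  have hsub : V ⊆ ⋃ N, φ N '' {t | t ∈ T ∧ ∃ v, rel N t v} := by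
    intro v hv
    obtain ⟨N, t, ht, h⟩ := hV v hv
    refine mem_iUnion.2 ⟨N, t, ⟨ht, v, h⟩, ?_⟩
    have := hrel N t t _ _ (hφ N t v h) h
    rw [sub_self, abs_zero, mul_zero] at this
    exact sub_eq_zero.1 (abs_nonpos_iff.1 this)
  refine measure_mono_null hsub (measure_iUnion_null fun N => ?_)
  refine LipschitzOnWith.volume_image_eq_zero (K := N) ?_
    (measure_mono_null (fun t ht => ht.1) hT)
  refine LipschitzOnWith.of_dist_le_mul fun t ht t' ht' => ?_
  obtain ⟨-, v, hv⟩ := ht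
  obtain ⟨-, v', hv'⟩ := ht'
  simpa [Real.dist_eq] using hrel N t t' _ _ (hφ N t v hv) (hφ N t' v' hv')

/-- The closed square of half-width `r`. -/
def box (r : ℝ) : Set (ℝ × ℝ) := {p | |p.1| ≤ r ∧ |p.2| ≤ r}

theorem box_eq_closedBall (r : ℝ) : box r = Metric.closedBall (0 : ℝ × ℝ) r := by
  ext p
  simp [box, Prod.norm_def]

theorem isCompact_box (r : ℝ) : IsCompact (box r) := by
  rw [box_eq_closedBall]
  exact isCompact_closedBall _ _

theorem volume_box_ne_zero {r : ℝ} (hr : 0 < r) : volume (box r) ≠ 0 := by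
  rw [box_eq_closedBall]
  exact (Metric.measure_closedBall_pos volume _ hr).ne'

/-- The function `f` tilted by the linear function of slope `p`. -/
def tilt (f : ℝ → ℝ → ℝ → ℝ) (p : ℝ × ℝ) (t x y : ℝ) : ℝ := f t x y - (p.1 * x + p.2 * y)

/-- Triples `(t, p, z)` such that the tilt of `f` by `p` attains at `(t, z)` its maximum over all
earlier times, with value at least `h₀`. -/
def recordSet (f : ℝ → ℝ → ℝ → ℝ) (τ r R h₀ : ℝ) : Set (ℝ × (ℝ × ℝ) × (ℝ × ℝ)) :=
  {q | q ∈ Icc 0 τ ×ˢ box r ×ˢ box R ∧ h₀ ≤ tilt f q.2.1 q.1 q.2.2.1 q.2.2.2 ∧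
    ∀ θ ∈ Icc (0 : ℝ) 1, ∀ x y : ℝ,
      tilt f q.2.1 (θ * q.1) x y ≤ tilt f q.2.1 q.1 q.2.2.1 q.2.2.2}

section Record

variable {f : ℝ → ℝ → ℝ → ℝ} {τ r R h₀ : ℝ}

theorem isCompact_recordSet
    (hc : ContinuousOn (fun q : ℝ × ℝ × ℝ => f q.1 q.2.1 q.2.2) (Icc 0 τ ×ˢ univ)) :
    IsCompact (recordSet f τ r R h₀) := by
  set P : Set (ℝ × (ℝ × ℝ) × (ℝ × ℝ)) := Icc 0 τ ×ˢ box r ×ˢ box R with hP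
  have hPc : IsCompact P := isCompact_Icc.prod ((isCompact_box r).prod (isCompact_box R))
  have hrhs : ContinuousOn (fun q : ℝ × (ℝ × ℝ) × (ℝ × ℝ) =>
      tilt f q.2.1 q.1 q.2.2.1 q.2.2.2) P := by
    refine ContinuousOn.sub ?_ (by fun_prop)
    exact hc.comp (f := fun q : ℝ × (ℝ × ℝ) × (ℝ × ℝ) => (q.1, q.2.2.1, q.2.2.2))
      (by fun_prop) fun q hq => ⟨hq.1, mem_univ _⟩
  have hlhs : ∀ θ ∈ Icc (0 : ℝ) 1, ∀ x y : ℝ, ContinuousOn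
      (fun q : ℝ × (ℝ × ℝ) × (ℝ × ℝ) => tilt f q.2.1 (θ * q.1) x y) P := by
    intro θ hθ x y
    refine ContinuousOn.sub ?_ (by fun_prop)
    refine hc.comp (f := fun q : ℝ × (ℝ × ℝ) × (ℝ × ℝ) => (θ * q.1, x, y))
      (by fun_prop) fun q hq => ⟨⟨mul_nonneg hθ.1 hq.1.1, ?_⟩, mem_univ _⟩
    exact (mul_le_of_le_one_left hq.1.1 hθ.2).trans hq.1.2
  have heq : recordSet f τ r R h₀ = {q | q ∈ P ∧ h₀ ≤ tilt f q.2.1 q.1 q.2.2.1 q.2.2.2} ∩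
      ⋂ (θ ∈ Icc (0 : ℝ) 1) (x : ℝ) (y : ℝ),
        {q | q ∈ P ∧ tilt f q.2.1 (θ * q.1) x y ≤ tilt f q.2.1 q.1 q.2.2.1 q.2.2.2} := by
    ext q
    simp only [mem_inter_iff, mem_iInter]
    exact ⟨fun h => ⟨⟨h.1, h.2.1⟩, fun θ hθ x y => ⟨h.1, h.2.2 θ hθ x y⟩⟩,
      fun h => ⟨h.1.1, h.1.2, fun θ hθ x y => (h.2 θ hθ x y).2⟩⟩
  refine hPc.of_isClosed_subset ?_ fun q hq => hq.1
  rw [heq]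
  refine (hPc.isClosed.isClosed_le continuousOn_const hrhs).inter ?_
  exact isClosed_iInter fun θ => isClosed_iInter fun hθ => isClosed_iInter fun x =>
    isClosed_iInter fun y => hPc.isClosed.isClosed_le (hlhs θ hθ x y) hrhs

theorem tilt_le_of_mem_recordSet {t : ℝ} {p z : ℝ × ℝ} (h : (t, p, z) ∈ recordSet f τ r R h₀)
    {s : ℝ} (hs : s ∈ Icc 0 t) (x y : ℝ) : tilt f p s x y ≤ tilt f p t z.1 z.2 := by
  rcases hs.1.trans hs.2 |>.eq_or_lt with ht | ht
  · have : s = t := le_antisymm hs.2 (ht ▸ hs.1)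
    simpa [this] using h.2.2 1 (by simp) x y
  · simpa [div_mul_cancel₀ _ ht.ne'] using
      h.2.2 (s / t) ⟨div_nonneg hs.1 ht.le, (div_le_one ht).2 hs.2⟩ x y

theorem touchedFromAbove_of_mem_recordSet {t : ℝ} {p z : ℝ × ℝ}
    (h : (t, p, z) ∈ recordSet f τ r R h₀) : TouchedFromAbove (f t) p z := by
  intro x y
  have := tilt_le_of_mem_recordSet h (right_mem_Icc.2 h.1.1.1) x y
  simp only [tilt] at this
  linarith

theorem exists_mem_recordSet_tilt_eq
    (hc : ContinuousOn (fun q : ℝ × ℝ × ℝ => f q.1 q.2.1 q.2.2) (Icc 0 τ ×ˢ univ))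
    {p : ℝ × ℝ} (hp : p ∈ box r) (hτ : 0 ≤ τ)
    (h0 : ∀ x y, tilt f p 0 x y < h₀)
    (hR : ∀ t ∈ Icc 0 τ, ∀ x y, h₀ ≤ tilt f p t x y → (x, y) ∈ box R)
    {v : ℝ} (hv₀ : h₀ ≤ v) (hv : ∃ x y, v ≤ tilt f p τ x y) :
    ∃ t z, (t, p, z) ∈ recordSet f τ r R h₀ ∧ tilt f p t z.1 z.2 = v := by
  have hct : ContinuousOn (fun q : ℝ × ℝ × ℝ => tilt f p q.1 q.2.1 q.2.2) (Icc 0 τ ×ˢ univ) :=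
    hc.sub (by fun_prop)
  set W : Set (ℝ × ℝ × ℝ) :=
    {q | q ∈ Icc 0 τ ×ˢ box R ∧ v ≤ tilt f p q.1 q.2.1 q.2.2} with hW
  have hcomp : IsCompact (Icc 0 τ ×ˢ box R) := isCompact_Icc.prod (isCompact_box R)
  have hWc : IsCompact W := hcomp.of_isClosed_subset
    (hcomp.isClosed.isClosed_le continuousOn_const
      (hct.mono (prod_mono le_rfl (subset_univ _)))) fun q hq => hq.1
  have hWne : W.Nonempty := by
    obtain ⟨x, y, hxy⟩ := hv
    exact ⟨(τ, x, y), ⟨right_mem_Icc.2 hτ,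
      hR τ (right_mem_Icc.2 hτ) x y (hv₀.trans hxy)⟩, hxy⟩
  obtain ⟨⟨t, z⟩, ⟨⟨htm, hzm⟩, htv⟩, hmin⟩ :=
    hWc.exists_isMinOn hWne continuous_fst.continuousOn
  simp only at htm hzm htv
  have hlt : ∀ s ∈ Ico 0 t, ∀ x y, tilt f p s x y < v := by
    intro s hs x y
    by_contra! hcon
    have hsm : s ∈ Icc 0 τ := ⟨hs.1, hs.2.le.trans htm.2⟩
    have : t ≤ s := hmin (a := (s, x, y)) ⟨⟨hsm, hR s hsm x y (hv₀.trans hcon)⟩, hcon⟩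
    exact absurd hs.2 this.not_gt
  have htpos : 0 < t := by
    rcases htm.1.eq_or_lt with h | h
    · rw [← h] at htv
      exact absurd (h0 z.1 z.2) (not_lt.2 (hv₀.trans htv))
    · exact h
  have hle : ∀ s ∈ Icc 0 t, ∀ x y, tilt f p s x y ≤ v := by
    intro s hs x y
    have hcl : s ∈ closure (Ico 0 t) := by rwa [closure_Ico htpos.ne]
    refine ContinuousWithinAt.closure_le (f := fun s => tilt f p s x y) (g := fun _ => v) hcl ?_
      continuousWithinAt_const fun s' hs' => (hlt s' hs' x y).le
    exact ((hct.comp (f := fun s => (s, x, y)) (s := Icc 0 τ) (by fun_prop)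
      fun s1 hs1 => ⟨hs1, mem_univ _⟩) s ⟨hs.1, hs.2.trans htm.2⟩).mono (Ico_subset_Icc_self.trans
        (Icc_subset_Icc_right htm.2))
  have heq : tilt f p t z.1 z.2 = v := le_antisymm (hle t (right_mem_Icc.2 htpos.le) _ _) htv
  refine ⟨t, z, ⟨⟨htm, hp, hzm⟩, hv₀.trans htv, fun θ hθ x y => ?_⟩, heq⟩
  exact (hle _ ⟨mul_nonneg hθ.1 htpos.le, mul_le_of_le_one_left htpos.le hθ.2⟩ x y).trans htv

end Record

theorem exists_record_point {f : ℝ → ℝ → ℝ → ℝ} {τ r R h₀ h₁ e : ℝ}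
    (hτ : 0 < τ) (hr : 0 < r) (h01 : h₀ < h₁) (he : 0 < e)
    (hc : ContinuousOn (fun q : ℝ × ℝ × ℝ => f q.1 q.2.1 q.2.2) (Icc 0 τ ×ˢ univ))
    (hF : ∀ t ∈ Ioc 0 τ, TwiceSepDifferentiable (f t))
    (ht : ∀ t ∈ Ioc 0 τ, ∀ x y, DifferentiableAt ℝ (fun s => f s x y) t)
    (h0 : ∀ p ∈ box r, ∀ x y, tilt f p 0 x y < h₀)
    (h1 : ∀ p ∈ box r, ∃ x y, h₁ ≤ tilt f p τ x y)
    (hR : ∀ p ∈ box r, ∀ t ∈ Icc 0 τ, ∀ x y, h₀ ≤ tilt f p t x y → (x, y) ∈ box R) :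
    ∃ t ∈ Ioc 0 τ, ∃ x y, ∃ p ∈ box r, h₀ ≤ tilt f p t x y ∧
      deriv (fun x' => f t x' y) x = p.1 ∧ deriv (fun y' => f t x y') y = p.2 ∧
      0 ≤ deriv (fun s => f s x y) t ∧
      ∀ ξ ζ : ℝ, deriv (deriv (fun x' => f t x' y)) x * ξ ^ 2
        + 2 * deriv (fun y' => deriv (fun x' => f t x' y') x) y * ξ * ζ
        + deriv (deriv (fun y' => f t x y')) y * ζ ^ 2 ≤ e * (ξ ^ 2 + ζ ^ 2) := by
  set E := recordSet f τ r R h₀ with hE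
  have hEc : IsCompact E := isCompact_recordSet hc
  have hEpos : ∀ {t p z}, (t, p, z) ∈ E → t ∈ Ioc 0 τ := by
    intro t p z h
    refine ⟨lt_of_le_of_ne h.1.1.1 ?_, h.1.1.2⟩
    rintro rfl
    exact absurd (h0 p h.1.2.1 z.1 z.2) (not_lt.2 h.2.1)
  have hEt : ∀ {t p z}, (t, p, z) ∈ E → ∀ s ∈ Icc 0 t, f s z.1 z.2 ≤ f t z.1 z.2 := by
    intro t p z h s hs
    have := tilt_le_of_mem_recordSet h hs z.1 z.2
    simp only [tilt] at this
    linarith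
  by_contra hcon
  have hcount : ∀ t x, {y | ∃ p, (t, p, (x, y)) ∈ E}.Countable := by
    intro t x
    by_contra hY
    obtain ⟨y₀, p₀, h₀'⟩ : {y | ∃ p, (t, p, (x, y)) ∈ E}.Nonempty := by
      by_contra hne
      rw [not_nonempty_iff_eq_empty.1 hne] at hY
      exact hY countable_empty
    have htm := hEpos h₀'
    obtain ⟨y, ⟨p, hpE⟩, hH⟩ := exists_hessian_le_of_not_countable (hF t htm) hY
      (fun y ⟨p, hp⟩ => ⟨p, touchedFromAbove_of_mem_recordSet hp⟩) he
    have hgrad := (touchedFromAbove_of_mem_recordSet hpE).sepGradient_eq (hF t htm)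
    exact hcon ⟨t, htm, x, y, p, hpE.1.2.1, hpE.2.1, congrArg Prod.fst hgrad,
      congrArg Prod.snd hgrad,
      deriv_nonneg_of_forall_Icc_le htm.1 (ht t htm x y) (hEt hpE), hH⟩
  set S : Set (ℝ × (ℝ × ℝ)) := (fun q => (q.1, q.2.1)) '' E with hS
  have hSm : MeasurableSet S := (hEc.image (by fun_prop)).measurableSet
  have hslice : ∀ t, volume (Prod.mk t ⁻¹' S) = 0 := by
    intro t
    have hmem : ∀ p ∈ Prod.mk t ⁻¹' S, ∃ z, (t, p, z) ∈ E := by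
      rintro p ⟨⟨t', p', z⟩, hq, heq⟩
      obtain ⟨rfl, rfl⟩ := Prod.mk.inj heq
      exact ⟨z, hq⟩
    rcases (Prod.mk t ⁻¹' S).eq_empty_or_nonempty with hemp | ⟨p₀, hp₀⟩
    · simp [hemp]
    obtain ⟨z₀, hz₀⟩ := hmem p₀ hp₀
    set K : Set (ℝ × ℝ) := (fun q : ℝ × (ℝ × ℝ) × (ℝ × ℝ) => q.2.2) '' (E ∩ {q | q.1 = t})
    have hKm : MeasurableSet K :=
      ((hEc.inter_right (isClosed_eq continuous_fst continuous_const)).image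
        (by fun_prop)).measurableSet
    have hK0 : volume K = 0 := by
      rw [Measure.volume_eq_prod, Measure.measure_prod_null hKm]
      refine Eventually.of_forall fun x => ?_
      refine ((hcount t x).mono ?_).measure_zero _
      rintro y ⟨⟨t', p, z⟩, ⟨hq, rfl⟩, rfl⟩
      exact ⟨p, hq⟩
    refine volume_slopes_eq_zero (hF t (hEpos hz₀)) hK0 (r := r) (fun p hp => ?_) fun p hp => ?_
    · obtain ⟨z, hz⟩ := hmem p hp
      exact hz.1.2.1
    · obtain ⟨z, hz⟩ := hmem p hp
      exact ⟨z, ⟨_, ⟨hz, rfl⟩, rfl⟩, touchedFromAbove_of_mem_recordSet hz⟩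
  have hS0 : (volume.prod volume : Measure (ℝ × (ℝ × ℝ))) S = 0 := by
    rw [Measure.measure_prod_null hSm]
    exact Eventually.of_forall hslice
  have hswap : (volume.prod volume : Measure ((ℝ × ℝ) × ℝ)) (Prod.swap ⁻¹' S) = 0 := by
    rw [Measure.measurePreserving_swap.measure_preimage hSm.nullMeasurableSet, hS0]
  have hae := Measure.measure_ae_null_of_prod_null hswap
  obtain ⟨p, hp, hpT⟩ : ∃ p ∈ box r, volume (Prod.mk p ⁻¹' (Prod.swap ⁻¹' S)) = 0 := by
    by_contra! hne
    exact volume_box_ne_zero hr (measure_mono_null (fun p hp => hne p hp) hae)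
  have hV : volume (Icc h₀ h₁) = 0 := by
    refine volume_eq_zero_of_lipschitz_relation hpT
      (fun N t v => ∃ z, (t, p, z) ∈ E ∧ tilt f p t z.1 z.2 = v ∧
        ∀ s ∈ Icc 0 t, f t z.1 z.2 - N * (t - s) ≤ f s z.1 z.2) ?_ ?_
    · intro v hv
      obtain ⟨x, y, hxy⟩ := h1 p hp
      obtain ⟨t, z, hz, hzv⟩ := exists_mem_recordSet_tilt_eq hc hp hτ.le (h0 p hp) (hR p hp)
        hv.1 ⟨x, y, hv.2.trans hxy⟩
      have htm := hEpos hz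
      obtain ⟨N, hN⟩ := exists_nat_left_lower_bound (g := fun s => f s z.1 z.2) (t := t)
        (hc.comp (f := fun s => (s, z.1, z.2)) (by fun_prop)
          fun s hs => ⟨⟨hs.1, hs.2.trans htm.2⟩, mem_univ _⟩) (ht t htm z.1 z.2)
      exact ⟨N, t, ⟨_, hz, rfl⟩, z, hz, hzv, hN⟩
    · have key : ∀ (N : ℕ) (t t' v v' : ℝ) (z z' : ℝ × ℝ), t ≤ t' → (t, p, z) ∈ E →
          (t', p, z') ∈ E → tilt f p t z.1 z.2 = v → tilt f p t' z'.1 z'.2 = v' →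
          (∀ s ∈ Icc 0 t', f t' z'.1 z'.2 - N * (t' - s) ≤ f s z'.1 z'.2) →
          v ≤ v' ∧ v' ≤ v + N * (t' - t) := by
        rintro N t t' _ _ z z' htt hz hz' rfl rfl hN
        have hts : t ∈ Icc 0 t' := ⟨hz.1.1.1, htt⟩
        refine ⟨tilt_le_of_mem_recordSet hz' hts _ _, ?_⟩
        have a1 := tilt_le_of_mem_recordSet hz (right_mem_Icc.2 hz.1.1.1) z'.1 z'.2
        have a2 := hN t hts
        simp only [tilt] at a1 ⊢
        linarith
      rintro N t t' v v' ⟨z, hz, hv, hN⟩ ⟨z', hz', hv', hN'⟩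
      rcases le_total t t' with h | h
      · obtain ⟨b1, b2⟩ := key N t t' v v' z z' h hz hz' hv hv' hN'
        rw [abs_sub_comm, abs_of_nonneg (by linarith), abs_sub_comm, abs_of_nonneg (by linarith)]
        linarith
      · obtain ⟨b1, b2⟩ := key N t' t v' v z' z h hz' hz hv' hv hN
        rw [abs_of_nonneg (by linarith), abs_of_nonneg (by linarith)]
        linarith
  rw [Real.volume_Icc, ENNReal.ofReal_eq_zero] at hV
  linarith

section Penalized

variable {W U : ℝ → ℝ → ℝ}

theorem hasDerivAt_penalized {g k : ℝ → ℝ} {x : ℝ} (l d c : ℝ) (hg : DifferentiableAt ℝ g x)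
    (hk : DifferentiableAt ℝ k x) :
    HasDerivAt (fun x' => g x' - l * k x' - d * (x' ^ 2 + c))
      (deriv g x - l * deriv k x - 2 * d * x) x := by
  refine ((hg.hasDerivAt.sub (hk.hasDerivAt.const_mul l)).sub
    ((((hasDerivAt_id x).pow 2).add_const c).const_mul d)).congr_deriv ?_
  simp; ring

theorem hasDerivAt_sub_const_mul_sub_linear {g k : ℝ → ℝ} {x : ℝ} (l d : ℝ)
    (hg : DifferentiableAt ℝ g x) (hk : DifferentiableAt ℝ k x) :
    HasDerivAt (fun x' => g x' - l * k x' - 2 * d * x')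
      (deriv g x - l * deriv k x - 2 * d) x := by
  refine ((hg.hasDerivAt.sub (hk.hasDerivAt.const_mul l)).sub
    ((hasDerivAt_id x).const_mul (2 * d))).congr_deriv ?_
  simp

theorem deriv_penalized_fst (hW : TwiceSepDifferentiable W) (hU : TwiceSepDifferentiable U)
    (l d y : ℝ) : deriv (fun x => W x y - l * U x y - d * (x ^ 2 + y ^ 2)) =
      fun x => deriv (fun x => W x y) x - l * deriv (fun x => U x y) x - 2 * d * x :=
  funext fun x => (hasDerivAt_penalized l d (y ^ 2) (hW x y).1 (hU x y).1).deriv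

theorem deriv_penalized_snd (hW : TwiceSepDifferentiable W) (hU : TwiceSepDifferentiable U)
    (l d x : ℝ) : deriv (fun y => W x y - l * U x y - d * (x ^ 2 + y ^ 2)) =
      fun y => deriv (fun y => W x y) y - l * deriv (fun y => U x y) y - 2 * d * y := by
  funext y
  simp only [add_comm (x ^ 2)]
  exact (hasDerivAt_penalized l d (x ^ 2) (hW x y).2.2.1 (hU x y).2.2.1).deriv

theorem hasDerivAt_penalized_mixed (hW : TwiceSepDifferentiable W)
    (hU : TwiceSepDifferentiable U) (l d x y : ℝ) :
    HasDerivAt (fun y' => deriv (fun x => W x y' - l * U x y' - d * (x ^ 2 + y' ^ 2)) x)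
      (deriv (fun y' => deriv (fun x => W x y') x) y
        - l * deriv (fun y' => deriv (fun x => U x y') x) y) y := by
  simp only [deriv_penalized_fst hW hU]
  exact ((hW x y).2.2.2.2.hasDerivAt.sub
    ((hU x y).2.2.2.2.hasDerivAt.const_mul l)).sub_const _

theorem TwiceSepDifferentiable.penalized (hW : TwiceSepDifferentiable W)
    (hU : TwiceSepDifferentiable U) (l d : ℝ) :
    TwiceSepDifferentiable fun x y => W x y - l * U x y - d * (x ^ 2 + y ^ 2) := by
  intro x y
  refine ⟨(hasDerivAt_penalized l d (y ^ 2) (hW x y).1 (hU x y).1).differentiableAt, ?_, ?_, ?_,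
    (hasDerivAt_penalized_mixed hW hU l d x y).differentiableAt⟩
  · rw [deriv_penalized_fst hW hU]
    exact (hasDerivAt_sub_const_mul_sub_linear l d (hW x y).2.1 (hU x y).2.1).differentiableAt
  · simp only [add_comm (x ^ 2)]
    exact (hasDerivAt_penalized l d (x ^ 2) (hW x y).2.2.1 (hU x y).2.2.1).differentiableAt
  · rw [deriv_penalized_snd hW hU]
    exact (hasDerivAt_sub_const_mul_sub_linear l d (hW x y).2.2.2.1
      (hU x y).2.2.2.1).differentiableAt

end Penalized

theorem sq_sub_mul_sq_le {p q l : ℝ} (hl0 : 0 ≤ l) (hl1 : l < 1) :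
    p ^ 2 - l * q ^ 2 ≤ (p - l * q) ^ 2 / (1 - l) := by
  rw [le_div_iff₀ (by linarith)]
  nlinarith [mul_nonneg hl0 (sq_nonneg (p - q))]

theorem correlated_trace_le {α β ρ A B C e : ℝ} (hρ : ρ ^ 2 ≤ 1)
    (h : ∀ ξ ζ : ℝ, A * ξ ^ 2 + 2 * B * ξ * ζ + C * ζ ^ 2 ≤ e * (ξ ^ 2 + ζ ^ 2)) :
    A * α ^ 2 + 2 * ρ * B * α * β + C * β ^ 2 ≤ e * (α ^ 2 + β ^ 2) := by
  have h1 := h α (ρ * β)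
  have h2 := h 0 1
  have h3 : (1 - ρ ^ 2) * β ^ 2 * C ≤ (1 - ρ ^ 2) * β ^ 2 * e :=
    mul_le_mul_of_nonneg_left (by linarith) (mul_nonneg (by linarith) (sq_nonneg β))
  linarith

/-- The total first-order coefficient of `∂ᵧ` in `Lop`. -/
noncomputable def driftY (m η ρ ε : ℝ) (b σ₁ σ₂ : ℝ → ℝ) (y : ℝ) : ℝ :=
  (m - y) / ε - (ρ / Real.sqrt ε) * (b y * σ₂ y / σ₁ y)
    - (η * Real.sqrt (1 - ρ ^ 2) / Real.sqrt ε) * (b y * σ₂ y / σ₁ y)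

theorem Lop_sub_mul_Lop_le {m γ η ρ ε l e vx vy : ℝ} {b σ₁ σ₂ : ℝ → ℝ} {W U : ℝ → ℝ → ℝ}
    {x y : ℝ} (hγ : 0 < γ) (hε : 0 < ε) (hρ : ρ ^ 2 ≤ 1) (hl0 : 0 ≤ l) (hl1 : l < 1)
    (hvx : deriv (fun x' => W x' y) x - l * deriv (fun x' => U x' y) x = vx)
    (hvy : deriv (fun y' => W x y') y - l * deriv (fun y' => U x y') y = vy)
    (hH : ∀ ξ ζ : ℝ,
      (deriv (deriv (fun x' => W x' y)) x - l * deriv (deriv (fun x' => U x' y)) x) * ξ ^ 2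
      + 2 * (deriv (fun y' => deriv (fun x' => W x' y') x) y
        - l * deriv (fun y' => deriv (fun x' => U x' y') x) y) * ξ * ζ
      + (deriv (deriv (fun y' => W x y')) y - l * deriv (deriv (fun y' => U x y')) y) * ζ ^ 2
      ≤ e * (ξ ^ 2 + ζ ^ 2)) :
    Lop m γ η ρ ε b σ₁ σ₂ W x y - l * Lop m γ η ρ ε b σ₁ σ₂ U x y ≤
      e / 2 * (σ₁ y ^ 2 + σ₂ y ^ 2 / ε) + driftY m η ρ ε b σ₁ σ₂ y * vy
        - σ₁ y ^ 2 / 2 * vx + γ * (1 - ρ ^ 2) / (2 * ε) * σ₂ y ^ 2 * (vy ^ 2 / (1 - l)) := by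
  have hq := mul_le_mul_of_nonneg_left
    (sq_sub_mul_sq_le (p := deriv (fun y' => W x y') y) (q := deriv (fun y' => U x y') y) hl0 hl1)
    (show 0 ≤ γ * (1 - ρ ^ 2) / (2 * ε) * σ₂ y ^ 2 from
      mul_nonneg (div_nonneg (mul_nonneg hγ.le (by linarith)) (by positivity)) (sq_nonneg _))
  have htr := correlated_trace_le (α := σ₁ y) (β := σ₂ y / Real.sqrt ε) hρ hH
  have hsrc : 0 ≤ (1 - l) * ((b y) ^ 2 / (2 * γ * (σ₁ y) ^ 2)) :=
    mul_nonneg (by linarith) (by positivity)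
  rw [div_pow, Real.sq_sqrt hε.le] at htr
  rw [hvy] at hq
  have hs : 1 / (2 * ε) * σ₂ y ^ 2 = σ₂ y ^ 2 / ε / 2 := by field_simp
  simp only [Lop, driftY, hs]
  rw [← hvx]
  rw [← hvy] at hq ⊢
  linear_combination hq + htr / 2 + hsrc

/-- A coefficient bounding `Lop W - l * Lop U` when the gradient and Hessian of `W - l * U` are
small. -/
noncomputable def operatorBound (m γ η ρ ε : ℝ) (b σ₁ σ₂ : ℝ → ℝ) (l G y : ℝ) : ℝ :=
  3 / 2 * (σ₁ y ^ 2 + σ₂ y ^ 2 / ε) + |driftY m η ρ ε b σ₁ σ₂ y| * G + σ₁ y ^ 2 / 2 * G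
    + γ * (1 - ρ ^ 2) / (2 * ε) * σ₂ y ^ 2 * (G ^ 2 / (1 - l))

theorem continuous_operatorBound {b σ₁ σ₂ : ℝ → ℝ} (hb : Continuous b) (h₁ : Continuous σ₁)
    (h₂ : Continuous σ₂) (h₁0 : ∀ y, σ₁ y ≠ 0) (m γ η ρ ε l G : ℝ) :
    Continuous (operatorBound m γ η ρ ε b σ₁ σ₂ l G) := by
  have hq : Continuous fun y => b y * σ₂ y / σ₁ y := (hb.mul h₂).div h₁ h₁0
  unfold operatorBound driftY
  fun_prop

theorem first_order_terms_le {m γ η ρ ε l G s e vx vy y : ℝ} {b σ₁ σ₂ : ℝ → ℝ} (hγ : 0 < γ)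
    (hε : 0 < ε) (hρ : ρ ^ 2 ≤ 1) (hl1 : l < 1) (hs0 : 0 ≤ s) (hs1 : s ≤ 1) (he : e ≤ 3 * s)
    (hx : |vx| ≤ s * G) (hy : |vy| ≤ s * G) :
    e / 2 * (σ₁ y ^ 2 + σ₂ y ^ 2 / ε) + driftY m η ρ ε b σ₁ σ₂ y * vy
        - σ₁ y ^ 2 / 2 * vx + γ * (1 - ρ ^ 2) / (2 * ε) * σ₂ y ^ 2 * (vy ^ 2 / (1 - l)) ≤
      s * operatorBound m γ η ρ ε b σ₁ σ₂ l G y := by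
  have h1 : e / 2 * (σ₁ y ^ 2 + σ₂ y ^ 2 / ε) ≤ 3 * s / 2 * (σ₁ y ^ 2 + σ₂ y ^ 2 / ε) :=
    mul_le_mul_of_nonneg_right (by linarith) (by positivity)
  have h2 : driftY m η ρ ε b σ₁ σ₂ y * vy ≤ |driftY m η ρ ε b σ₁ σ₂ y| * (s * G) :=
    (le_abs_self _).trans ((abs_mul _ _).trans_le (mul_le_mul_of_nonneg_left hy (abs_nonneg _)))
  have h3 : σ₁ y ^ 2 / 2 * -vx ≤ σ₁ y ^ 2 / 2 * (s * G) :=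
    mul_le_mul_of_nonneg_left ((neg_le_abs vx).trans hx) (by positivity)
  have h4 : vy ^ 2 ≤ s * G ^ 2 := by
    have : vy ^ 2 ≤ (s * G) ^ 2 := sq_le_sq' (by linarith [(abs_le.1 hy).1]) (abs_le.1 hy).2
    have hss : s ^ 2 ≤ s := by nlinarith
    nlinarith [mul_le_mul_of_nonneg_right hss (sq_nonneg G)]
  have h5 := mul_le_mul_of_nonneg_left
    (div_le_div_of_nonneg_right h4 (by linarith : 0 ≤ 1 - l))
    (show 0 ≤ γ * (1 - ρ ^ 2) / (2 * ε) * σ₂ y ^ 2 from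
      mul_nonneg (div_nonneg (mul_nonneg hγ.le (by linarith)) (by positivity)) (sq_nonneg _))
  rw [mul_div_assoc s] at h5
  unfold operatorBound
  linear_combination h1 + h2 + h3 + h5

theorem abs_linear_le_of_mem_box {p : ℝ × ℝ} {r : ℝ} (hp : p ∈ box r) (x y : ℝ) :
    |p.1 * x + p.2 * y| ≤ r * (|x| + |y|) := by
  refine (abs_add_le _ _).trans ?_
  rw [abs_mul, abs_mul, mul_add]
  exact add_le_add (mul_le_mul_of_nonneg_right hp.1 (abs_nonneg _))
    (mul_le_mul_of_nonneg_right hp.2 (abs_nonneg _))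

theorem neg_linear_le_of_mem_box {p : ℝ × ℝ} {r : ℝ} (hr : 0 ≤ r) (hp : p ∈ box r) (x y : ℝ) :
    -(p.1 * x + p.2 * y) ≤ r / 2 * (x ^ 2 + y ^ 2) + r := by
  have h1 := (neg_le_abs _).trans (abs_linear_le_of_mem_box hp x y)
  have h2 : |x| + |y| ≤ (x ^ 2 + y ^ 2) / 2 + 1 := by
    nlinarith [sq_nonneg (|x| - 1), sq_nonneg (|y| - 1), sq_abs x, sq_abs y]
  nlinarith [mul_le_mul_of_nonneg_left h2 hr]

theorem abs_add_two_mul_sq_mul_le {s q x D : ℝ} (hs0 : 0 ≤ s) (hs1 : s ≤ 1) (hq : |q| ≤ s ^ 2)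
    (hx : s ^ 2 * x ^ 2 ≤ 2 * D) : |q + 2 * s ^ 2 * x| ≤ s * (2 * Real.sqrt (2 * D) + 1) := by
  have h1 : |s * x| ≤ Real.sqrt (2 * D) := Real.abs_le_sqrt (by rw [mul_pow]; exact hx)
  have h2 : |2 * s ^ 2 * x| = 2 * s * |s * x| := by
    rw [show 2 * s ^ 2 * x = 2 * s * (s * x) by ring, abs_mul, abs_of_nonneg (by linarith)]
  have h3 := mul_le_mul_of_nonneg_left h1 (by linarith : 0 ≤ 2 * s)
  have h4 : s ^ 2 ≤ s := by nlinarith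
  have := abs_add_le q (2 * s ^ 2 * x)
  linarith

theorem TwiceSepDifferentiable.of_C122On {s : Set ℝ} {u : ℝ → ℝ → ℝ → ℝ} (hu : C122On s u)
    {t : ℝ} (ht : t ∈ s) : TwiceSepDifferentiable (u t) :=
  fun x y => (hu t ht x y).2

section Penalized

variable {W U : ℝ → ℝ → ℝ} {l d x y : ℝ}

theorem hessian_le_of_penalized_hessian_le {e : ℝ} (hW : TwiceSepDifferentiable W)
    (hU : TwiceSepDifferentiable U)
    (hH : ∀ ξ ζ : ℝ,
      deriv (deriv (fun x' => W x' y - l * U x' y - d * (x' ^ 2 + y ^ 2))) x * ξ ^ 2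
      + 2 * deriv (fun y' => deriv (fun x' => W x' y' - l * U x' y' - d * (x' ^ 2 + y' ^ 2)) x) y
        * ξ * ζ
      + deriv (deriv (fun y' => W x y' - l * U x y' - d * (x ^ 2 + y' ^ 2))) y * ζ ^ 2
      ≤ e * (ξ ^ 2 + ζ ^ 2)) (ξ ζ : ℝ) :
    (deriv (deriv (fun x' => W x' y)) x - l * deriv (deriv (fun x' => U x' y)) x) * ξ ^ 2
      + 2 * (deriv (fun y' => deriv (fun x' => W x' y') x) y
        - l * deriv (fun y' => deriv (fun x' => U x' y') x) y) * ξ * ζ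
      + (deriv (deriv (fun y' => W x y')) y - l * deriv (deriv (fun y' => U x y')) y) * ζ ^ 2
      ≤ (e + 2 * d) * (ξ ^ 2 + ζ ^ 2) := by
  have h := hH ξ ζ
  rw [(hasDerivAt_penalized_mixed hW hU l d x y).deriv, deriv_penalized_fst hW hU,
    deriv_penalized_snd hW hU,
    (hasDerivAt_sub_const_mul_sub_linear l d (hW x y).2.1 (hU x y).2.1).deriv,
    (hasDerivAt_sub_const_mul_sub_linear l d (hW x y).2.2.2.1 (hU x y).2.2.2.1).deriv] at h
  linarith

end Penalized

theorem comparison_interior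
    {T m γ η ρ ε : ℝ} (hε : 0 < ε) (hγ : 0 < γ) (hρ : ρ ^ 2 ≤ 1)
    {b σ₁ σ₂ : ℝ → ℝ} (hbc : Continuous b) (hσ₁c : Continuous σ₁) (hσ₂c : Continuous σ₂)
    (hσ₁ : ∀ y, σ₁ y ≠ 0) {u w : ℝ → ℝ → ℝ → ℝ} {M : ℝ}
    (hM : ∀ τ ∈ Icc 0 T, ∀ x y : ℝ, |u τ x y| ≤ M)
    (huc : ContinuousOn (fun p : ℝ × ℝ × ℝ => u p.1 p.2.1 p.2.2) (Icc 0 T ×ˢ univ))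
    (huC : C122On (Ioo 0 T) u)
    (huPDE : ∀ τ ∈ Ioo 0 T, ∀ x y : ℝ,
      deriv (fun t => u t x y) τ = Lop m γ η ρ ε b σ₁ σ₂ (u τ) x y)
    (hwc : ContinuousOn (fun p : ℝ × ℝ × ℝ => w p.1 p.2.1 p.2.2) (Icc 0 T ×ˢ univ))
    (hwC : C122On (Ioo 0 T) w)
    {κ : ℝ} (hκ : 0 < κ)
    (hwsub : ∀ τ ∈ Ioo 0 T, ∀ x y : ℝ,
      deriv (fun t => w t x y) τ - Lop m γ η ρ ε b σ₁ σ₂ (w τ) x y ≤ -κ)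
    {C₀ c₀ : ℝ} (hc₀ : 0 < c₀)
    (hgrow : ∀ τ ∈ Icc 0 T, ∀ x y : ℝ, w τ x y ≤ C₀ - c₀ * (y - m) ^ 2)
    (hinit : ∀ x y : ℝ, w 0 x y ≤ u 0 x y) {τ : ℝ} (hτ : τ ∈ Ioo 0 T) (x₀ y₀ : ℝ) :
    w τ x₀ y₀ ≤ u τ x₀ y₀ := by
  by_contra! hlt
  have hT0 : 0 < T := hτ.1.trans hτ.2
  have hM0 : 0 ≤ M := (abs_nonneg _).trans (hM 0 ⟨le_rfl, hT0.le⟩ 0 0)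
  obtain ⟨a, ha, ha0⟩ : ∃ a, a = w τ x₀ y₀ - u τ x₀ y₀ ∧ 0 < a := ⟨_, rfl, by linarith⟩
  obtain ⟨l, hl0, hl1, hlM⟩ : ∃ l : ℝ, 0 ≤ l ∧ l < 1 ∧ (1 - l) * M ≤ a / 4 := by
    refine ⟨1 - min (1 / 2) (a / (4 * (M + 1))), ?_, ?_, ?_⟩
    · linarith [min_le_left (1 / 2) (a / (4 * (M + 1)))]
    · have : 0 < min (1 / 2) (a / (4 * (M + 1))) := by positivity
      linarith
    · have h1 : a / (4 * (M + 1)) * (M + 1) = a / 4 := by field_simp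
      have h2 := min_le_right (1 / 2) (a / (4 * (M + 1)))
      have h3 : 0 < a / (4 * (M + 1)) := by positivity
      nlinarith [mul_le_mul_of_nonneg_right h2 hM0]
  obtain ⟨D, hD⟩ : ∃ D, D = C₀ + M + 1 := ⟨_, rfl⟩
  obtain ⟨C, hC⟩ := (isCompact_Icc (a := m - Real.sqrt (D / c₀))
    (b := m + Real.sqrt (D / c₀))).exists_bound_of_continuousOn
    (continuous_operatorBound hbc hσ₁c hσ₂c hσ₁ m γ η ρ ε l
      (2 * Real.sqrt (2 * D) + 1)).continuousOn
  obtain ⟨s, hs0, hs1, hsa, hsC, hsx⟩ : ∃ s : ℝ, 0 < s ∧ s ≤ 1 ∧ s ≤ a / 8 ∧ s * C < κ ∧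
      s * (x₀ ^ 2 + y₀ ^ 2 + (|x₀| + |y₀|)) ≤ a / 8 := by
    have hlim : ∀ c : ℝ, Tendsto (fun s : ℝ => s * c) (𝓝[>] 0) (𝓝 0) := fun c => by
      have : Tendsto (fun s : ℝ => s * c) (𝓝 0) (𝓝 (0 * c)) :=
        (continuous_id.mul continuous_const).tendsto 0
      rw [zero_mul] at this
      exact this.mono_left nhdsWithin_le_nhds
    have h1 := (hlim 1).eventually_lt_const (zero_lt_one)
    have h2 := (hlim 1).eventually_lt_const (show 0 < a / 8 by positivity)
    have h3 := (hlim C).eventually_lt_const hκ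
    have h4 := (hlim (x₀ ^ 2 + y₀ ^ 2 + (|x₀| + |y₀|))).eventually_lt_const
      (show 0 < a / 8 by positivity)
    obtain ⟨s, h0, h1, h2, h3, h4⟩ := (eventually_mem_nhdsWithin.and
      (h1.and (h2.and (h3.and h4)))).exists
    rw [mul_one] at h1 h2
    exact ⟨s, h0, h1.le, h2.le, h3, h4.le⟩
  have hss : s ^ 2 ≤ s := by nlinarith
  have hs2 : 0 < s ^ 2 := by positivity
  have hlu : ∀ t ∈ Icc 0 T, ∀ x y, |(1 - l) * u t x y| ≤ a / 4 := fun t ht x y => by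
    rw [abs_mul, abs_of_nonneg (by linarith)]
    exact (mul_le_mul_of_nonneg_left (hM t ht x y) (by linarith)).trans hlM
  have hIcc : ∀ t ∈ Icc 0 τ, t ∈ Icc 0 T := fun t ht => ⟨ht.1, ht.2.trans hτ.2.le⟩
  have hIoc : ∀ t ∈ Ioc 0 τ, t ∈ Ioo 0 T := fun t ht => ⟨ht.1, ht.2.trans_lt hτ.2⟩
  set f : ℝ → ℝ → ℝ → ℝ := fun t x y => w t x y - l * u t x y - s ^ 2 * (x ^ 2 + y ^ 2) with hf
  have hbound : ∀ p ∈ box (s ^ 2), ∀ t ∈ Icc 0 τ, ∀ x y, a / 2 ≤ tilt f p t x y →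
      c₀ * (y - m) ^ 2 + s ^ 2 / 2 * (x ^ 2 + y ^ 2) ≤ D := by
    intro p hp t ht x y h
    have h1 := neg_linear_le_of_mem_box hs2.le hp x y
    have h2 := hgrow t (hIcc t ht) x y
    have h3 : l * -u t x y ≤ M := by
      have := (neg_le_abs _).trans (hM t (hIcc t ht) x y)
      nlinarith
    simp only [tilt, hf] at h
    linarith
  obtain ⟨t, ht, x, y, p, hp, hv, hfx, hfy, hft, hH⟩ :=
    exists_record_point (f := f) (τ := τ) (r := s ^ 2) (R := Real.sqrt (2 * D / s ^ 2))
      (h₀ := a / 2) (h₁ := 5 * a / 8) (e := s ^ 2) hτ.1 hs2 (by linarith) hs2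
      (by
        have hsub : Icc 0 τ ×ˢ (univ : Set (ℝ × ℝ)) ⊆ Icc 0 T ×ˢ univ :=
          prod_mono_left (fun t => hIcc t)
        exact ((hwc.mono hsub).sub (continuousOn_const.mul (huc.mono hsub))).sub
          (by fun_prop))
      (fun t ht => (TwiceSepDifferentiable.of_C122On hwC (hIoc t ht)).penalized
        (TwiceSepDifferentiable.of_C122On huC (hIoc t ht)) l (s ^ 2))
      (fun t ht x y => (((hwC t (hIoc t ht) x y).1.sub
        ((huC t (hIoc t ht) x y).1.const_mul l)).sub_const _))
      (by
        intro p hp x y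
        have h1 := neg_linear_le_of_mem_box hs2.le hp x y
        have h2 := hinit x y
        have h3 := (le_abs_self _).trans (hlu 0 ⟨le_rfl, hT0.le⟩ x y)
        have h4 : 0 ≤ s ^ 2 * (x ^ 2 + y ^ 2) := by positivity
        simp only [tilt, hf]
        linarith)
      (by
        intro p hp
        refine ⟨x₀, y₀, ?_⟩
        have h1 := (le_abs_self _).trans (abs_linear_le_of_mem_box hp x₀ y₀)
        have h3 := (neg_le_abs _).trans (hlu τ ⟨hτ.1.le, hτ.2.le⟩ x₀ y₀)
        have h4 := mul_le_mul_of_nonneg_right hss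
          (show 0 ≤ x₀ ^ 2 + y₀ ^ 2 + (|x₀| + |y₀|) by positivity)
        simp only [tilt, hf]
        linarith)
      (by
        intro p hp t ht x y h
        have h1 := hbound p hp t ht x y h
        have h2 : 0 ≤ c₀ * (y - m) ^ 2 := by positivity
        constructor
        all_goals
          refine Real.abs_le_sqrt ((le_div_iff₀ hs2).2 ?_)
          nlinarith [mul_nonneg hs2.le (sq_nonneg x), mul_nonneg hs2.le (sq_nonneg y)])
  have hW := TwiceSepDifferentiable.of_C122On hwC (hIoc t ht)
  have hU := TwiceSepDifferentiable.of_C122On huC (hIoc t ht)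
  have hb := hbound p hp t ⟨ht.1.le, ht.2⟩ x y hv
  have hx2 : 0 ≤ s ^ 2 * x ^ 2 := by positivity
  have hy2 : 0 ≤ s ^ 2 * y ^ 2 := by positivity
  have hm2 : 0 ≤ c₀ * (y - m) ^ 2 := by positivity
  simp only [hf] at hfx hfy hH
  rw [deriv_penalized_fst hW hU] at hfx
  rw [deriv_penalized_snd hW hU] at hfy
  have hym : |y - m| ≤ Real.sqrt (D / c₀) :=
    Real.abs_le_sqrt ((le_div_iff₀ hc₀).2 (by linarith))
  have hΦ := (le_abs_self _).trans (hC y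
    ⟨by linarith [(abs_le.1 hym).1], by linarith [(abs_le.1 hym).2]⟩)
  have hop := Lop_sub_mul_Lop_le (m := m) (η := η) (b := b) (σ₁ := σ₁) (σ₂ := σ₂) hγ hε hρ hl0 hl1
    (sub_eq_iff_eq_add.1 hfx) (sub_eq_iff_eq_add.1 hfy)
    (hessian_le_of_penalized_hessian_le hW hU hH)
  have hfirst := first_order_terms_le (m := m) (η := η) (b := b) (σ₁ := σ₁) (σ₂ := σ₂) (y := y)
    hγ hε hρ hl1 hs0.le hs1 (show s ^ 2 + 2 * s ^ 2 ≤ 3 * s by linarith)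
    (abs_add_two_mul_sq_mul_le (x := x) (D := D) hs0.le hs1 hp.1 (by linarith))
    (abs_add_two_mul_sq_mul_le (x := y) (D := D) hs0.le hs1 hp.2 (by linarith))
  have htime : deriv (fun s' => f s' x y) t =
      deriv (fun s' => w s' x y) t - l * deriv (fun s' => u s' x y) t :=
    (((hwC t (hIoc t ht) x y).1.hasDerivAt.sub
      ((huC t (hIoc t ht) x y).1.hasDerivAt.const_mul l)).sub_const _).deriv
  rw [htime, huPDE t (hIoc t ht) x y] at hft
  have hsub := hwsub t (hIoc t ht) x y
  have hfin := mul_le_mul_of_nonneg_left hΦ hs0.le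
  linarith

end Comparison

/-- comparison principle for the pricing operator `L_ε`. If `u` is a
bounded solution of `∂_τu = L_εu` on `(0,T) × ℝ × ℝ` and `w` is a strict subsolution
(`∂_τw - L_εw ≤ -κ < 0`) with growth bound `w ≤ C₀ - c₀(y-m)²` and `w(0,·,·) ≤ u(0,·,·)`,
then `w ≤ u` everywhere on `[0,T] × ℝ × ℝ`. -/
theorem comparison_principle
    (T m γ η ρ ε : ℝ) (hT : 0 < T) (hε : 0 < ε) (hγ : 0 < γ)
    (hρ : -1 < ρ ∧ ρ < 1)
    (b σ₁ σ₂ : ℝ → ℝ)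
    (hbc : Continuous b) (hσ₁c : Continuous σ₁) (hσ₂c : Continuous σ₂)
    (c₁ C₁ c₂ C₂ Cb : ℝ)
    (hc₁ : 0 < c₁) (hσ₁ : ∀ y, c₁ ≤ σ₁ y ∧ σ₁ y ≤ C₁)
    (hc₂ : 0 < c₂) (hσ₂ : ∀ y, c₂ ≤ σ₂ y ∧ σ₂ y ≤ C₂)
    (hbb : ∀ y, |b y| ≤ Cb)
    (u w : ℝ → ℝ → ℝ → ℝ)
    (hub : ∃ M, ∀ τ ∈ Set.Icc 0 T, ∀ x y : ℝ, |u τ x y| ≤ M)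
    (huc : ContinuousOn (fun p : ℝ × ℝ × ℝ => u p.1 p.2.1 p.2.2)
      (Set.Icc 0 T ×ˢ (Set.univ : Set (ℝ × ℝ))))
    (huC : C122On (Set.Ioo 0 T) u)
    (huPDE : ∀ τ ∈ Set.Ioo 0 T, ∀ x y : ℝ,
      deriv (fun t => u t x y) τ = Lop m γ η ρ ε b σ₁ σ₂ (u τ) x y)
    (hwc : ContinuousOn (fun p : ℝ × ℝ × ℝ => w p.1 p.2.1 p.2.2)
      (Set.Icc 0 T ×ˢ (Set.univ : Set (ℝ × ℝ))))
    (hwC : C122On (Set.Ioo 0 T) w)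
    (κ : ℝ) (hκ : 0 < κ)
    (hwsub : ∀ τ ∈ Set.Ioo 0 T, ∀ x y : ℝ,
      deriv (fun t => w t x y) τ - Lop m γ η ρ ε b σ₁ σ₂ (w τ) x y ≤ -κ)
    (C₀ c₀ : ℝ) (hc₀ : 0 < c₀)
    (hgrow : ∀ τ ∈ Set.Icc 0 T, ∀ x y : ℝ, w τ x y ≤ C₀ - c₀ * (y - m) ^ 2)
    (hinit : ∀ x y : ℝ, w 0 x y ≤ u 0 x y) :
    ∀ τ ∈ Set.Icc 0 T, ∀ x y : ℝ, w τ x y ≤ u τ x y := by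
  obtain ⟨M, hM⟩ := hub
  have hopen : ∀ t ∈ Set.Ioo 0 T, ∀ x y : ℝ, w t x y ≤ u t x y := fun t ht x y =>
    comparison_interior hε hγ (by nlinarith [hρ.1, hρ.2]) hbc hσ₁c hσ₂c
      (fun z => (hc₁.trans_le (hσ₁ z).1).ne') hM huc huC huPDE hwc hwC hκ hwsub hc₀ hgrow hinit
      ht x y
  intro τ hτ x y
  have hline : ∀ {g : ℝ → ℝ → ℝ → ℝ},
      ContinuousOn (fun p : ℝ × ℝ × ℝ => g p.1 p.2.1 p.2.2)
        (Set.Icc 0 T ×ˢ (Set.univ : Set (ℝ × ℝ))) →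
      ContinuousOn (fun t => g t x y) (Set.Icc 0 T) := fun hg =>
    hg.comp (f := fun t : ℝ => (t, x, y)) (by fun_prop) fun t ht => ⟨ht, trivial⟩
  have hcl : τ ∈ closure (Set.Ioo 0 T) := by rwa [closure_Ioo hT.ne]
  exact ContinuousWithinAt.closure_le (f := fun t => w t x y) (g := fun t => u t x y) hcl
    ((hline hwc τ hτ).mono Set.Ioo_subset_Icc_self)
    ((hline huc τ hτ).mono Set.Ioo_subset_Icc_self) fun t ht => hopen t ht x y
end
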